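/- arXiv:2603.02950 — 8 statements merged into one kernel-verified Lean document; each statement's English description precedes it below -/
import Mathlib

section
/- Consider the planar vector field F(θ, p) = (θ(1−θ)((1−p)(1−θ) − Δ p θ), κ p(1−p)((1−θ)² − (1−θ_a)²)) with parameters θ_a ∈ (0,1), κ > 0, Δ > 0. For every initial condition (θ₀, p₀) ∈ [0,1]², there exists a unique solution (θ(t), p(t)) of the ODE (θ', p') = F(θ, p) with (θ(0), p(0)) = (θ₀, p₀), defined for all t ≥ 0, and this solution satisfies (θ(t), p(t)) ∈ [0,1]² for all t ≥ 0. -/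
open Set

section GlobalSolutions

variable {E : Type*} [NormedAddCommGroup E] [NormedSpace ℝ E]

/-- Two forward solutions of an autonomous ODE with locally Lipschitz vector field agree as soon as
their initial values do. -/
theorem LocallyLipschitz.eqOn_Ici_of_hasDerivWithinAt {F : E → E} (hF : LocallyLipschitz F)
    {x y : ℝ → E} (hx : ∀ t ∈ Ici (0 : ℝ), HasDerivWithinAt x (F (x t)) (Ici 0) t)
    (hy : ∀ t ∈ Ici (0 : ℝ), HasDerivWithinAt y (F (y t)) (Ici 0) t) (h : x 0 = y 0) :
    EqOn x y (Ici 0) := by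
  intro T hT
  have hcont {z : ℝ → E} (hz : ∀ t ∈ Ici (0 : ℝ), HasDerivWithinAt z (F (z t)) (Ici 0) t) :
      ContinuousOn z (Icc 0 T) := fun t ht ↦
    (hz t ht.1).continuousWithinAt.mono Icc_subset_Ici_self
  obtain ⟨K, hK⟩ := (hF.locallyLipschitzOn (s := x '' Icc 0 T ∪ y '' Icc 0 T)
    ).exists_lipschitzOnWith_of_compact
      ((isCompact_Icc.image_of_continuousOn (hcont hx)).union
        (isCompact_Icc.image_of_continuousOn (hcont hy)))
  exact ODE_solution_unique_of_mem_Icc_right (v := fun _ ↦ F) (fun _ _ ↦ hK)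
    (hcont hx) (fun t ht ↦ (hx t ht.1).mono (Ici_subset_Ici.2 ht.1))
    (fun t ht ↦ Or.inl (mem_image_of_mem x (Ico_subset_Icc_self ht)))
    (hcont hy) (fun t ht ↦ (hy t ht.1).mono (Ici_subset_Ici.2 ht.1))
    (fun t ht ↦ Or.inr (mem_image_of_mem y (Ico_subset_Icc_self ht))) h ⟨hT, le_rfl⟩

/-- A bounded globally Lipschitz autonomous vector field has forward solutions for all time. -/
theorem LipschitzWith.exists_hasDerivWithinAt_Ici [CompleteSpace E] {F : E → E} {K L : NNReal}
    (hF : LipschitzWith K F) (hL : ∀ x, ‖F x‖ ≤ L) (x₀ : E) :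
    ∃ x : ℝ → E, x 0 = x₀ ∧ ∀ t ∈ Ici (0 : ℝ), HasDerivWithinAt x (F (x t)) (Ici 0) t := by
  have hloc (n : ℕ) : ∃ x : ℝ → E, x 0 = x₀ ∧
      ∀ t ∈ Icc (0 : ℝ) n, HasDerivWithinAt x (F (x t)) (Icc 0 n) t :=
    (IsPicardLindelof.of_time_independent (t₀ := ⟨0, le_rfl, n.cast_nonneg⟩) (a := L * n) (r := 0)
      (fun x _ ↦ hL x) hF.lipschitzOnWith (by simp)).exists_eq_forall_mem_Icc_hasDerivWithinAt₀
  choose x hx0 hx using hloc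
  have heq {m n : ℕ} (hmn : m ≤ n) : EqOn (x m) (x n) (Icc 0 m) := by
    have hsub : Icc (0 : ℝ) m ⊆ Icc 0 n := Icc_subset_Icc_right (Nat.cast_le.2 hmn)
    have hnhds {k : ℕ} {t : ℝ} (ht : t ∈ Ico (0 : ℝ) k) : Icc (0 : ℝ) k ∈ nhdsWithin t (Ici t) :=
      Filter.mem_of_superset (Icc_mem_nhdsGE ht.2) (Icc_subset_Icc_left ht.1)
    refine ODE_solution_unique (v := fun _ ↦ F) (fun _ ↦ hF)
      (fun t ht ↦ (hx m t ht).continuousWithinAt)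
      (fun t ht ↦ (hx m t (Ico_subset_Icc_self ht)).mono_of_mem_nhdsWithin (hnhds ht))
      (fun t ht ↦ (hx n t (hsub ht)).continuousWithinAt.mono hsub)
      (fun t ht ↦ (hx n t (hsub (Ico_subset_Icc_self ht))).mono_of_mem_nhdsWithin
        (hnhds ⟨ht.1, ht.2.trans_le (Nat.cast_le.2 hmn)⟩)) ((hx0 m).trans (hx0 n).symm)
  refine ⟨fun t ↦ x ⌈t⌉₊ t, hx0 _, fun t ht ↦ ?_⟩
  obtain ⟨n, hn⟩ := exists_nat_gt t
  have hglue : ∀ s ∈ Icc (0 : ℝ) n, x ⌈s⌉₊ s = x n s := fun s hs ↦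
    heq (Nat.ceil_le.2 hs.2) ⟨hs.1, Nat.le_ceil s⟩
  have hmem : Icc (0 : ℝ) n ∈ nhdsWithin t (Ici 0) := by
    rw [← Ici_inter_Iic]
    exact Filter.inter_mem self_mem_nhdsWithin (mem_nhdsWithin_of_mem_nhds (Iic_mem_nhds hn))
  have htn : t ∈ Icc (0 : ℝ) n := ⟨ht, hn.le⟩
  have := (hx n t htn).congr_of_mem hglue htn
  rw [← hglue t htn] at this
  exact this.mono_of_mem_nhdsWithin hmem

end GlobalSolutions

/-- A function on `[0, ∞)` starting below `c` whose derivative is nonpositive wherever its value is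
at least `c` stays below `c`. -/
theorem le_of_hasDerivWithinAt_nonpos_of_le {f f' : ℝ → ℝ} {c : ℝ}
    (hf : ∀ t ∈ Ici (0 : ℝ), HasDerivWithinAt f (f' t) (Ici 0) t) (h0 : f 0 ≤ c)
    (hc : ∀ t ∈ Ici (0 : ℝ), c ≤ f t → f' t ≤ 0) {t : ℝ} (ht : t ∈ Ici (0 : ℝ)) : f t ≤ c := by
  rw [mem_Ici] at ht
  have key (ε : ℝ) (hε : 0 < ε) : f t ≤ c + ε * t := by
    refine image_le_of_deriv_right_lt_deriv_boundary (B := fun s ↦ c + ε * s) (B' := fun _ ↦ ε)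
      (fun s hs ↦ (hf s hs.1).continuousWithinAt.mono Icc_subset_Ici_self)
      (fun s hs ↦ (hf s hs.1).mono (Ici_subset_Ici.2 hs.1)) (by simpa using h0)
      (fun s ↦ by simpa using ((hasDerivAt_id s).const_mul ε).const_add c)
      (fun s hs h ↦ (hc s hs.1 ?_).trans_lt hε) ⟨ht, le_rfl⟩
    rw [h]
    exact le_add_of_nonneg_right (mul_nonneg hε.le hs.1)
  refine le_of_forall_pos_le_add fun δ hδ ↦ (key (δ / (t + 1)) (by positivity)).trans ?_
  gcongr
  rw [div_mul_eq_mul_div, div_le_iff₀ (by positivity)]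
  nlinarith

/-- A function on `[0, ∞)` starting in `[a, b]` whose derivative vanishes wherever its value is
outside `(a, b)` stays in `[a, b]`. -/
theorem mem_Icc_of_hasDerivWithinAt_eq_zero {f f' : ℝ → ℝ} {a b : ℝ}
    (hf : ∀ t ∈ Ici (0 : ℝ), HasDerivWithinAt f (f' t) (Ici 0) t) (h0 : f 0 ∈ Icc a b)
    (hc : ∀ t ∈ Ici (0 : ℝ), f t ∉ Ioo a b → f' t = 0) {t : ℝ} (ht : t ∈ Ici (0 : ℝ)) :
    f t ∈ Icc a b := by
  refine ⟨?_, le_of_hasDerivWithinAt_nonpos_of_le hf h0.2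
    (fun s hs h ↦ (hc s hs fun h' ↦ h'.2.not_ge h).le) ht⟩
  exact neg_le_neg_iff.1 <| le_of_hasDerivWithinAt_nonpos_of_le (fun s hs ↦ (hf s hs).neg)
    (neg_le_neg h0.1)
    (fun s hs h ↦ by simp [hc s hs fun h' ↦ h'.1.not_ge (neg_le_neg_iff.1 h)]) ht

/-- The coupled skill–delegation vector field. -/
def skillDelegationField (θa κ Δ : ℝ) (x : ℝ × ℝ) : ℝ × ℝ :=
  (x.1 * (1 - x.1) * ((1 - x.2) * (1 - x.1) - Δ * x.2 * x.1),
    κ * x.2 * (1 - x.2) * ((1 - x.1) ^ 2 - (1 - θa) ^ 2))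

theorem locallyLipschitz_skillDelegationField (θa κ Δ : ℝ) :
    LocallyLipschitz (skillDelegationField θa κ Δ) := by
  have : ContDiff ℝ 1 (skillDelegationField θa κ Δ) := by
    unfold skillDelegationField
    fun_prop
  exact this.locallyLipschitz

/-- The retraction of the plane onto the unit square. -/
noncomputable def clampSquare (x : ℝ × ℝ) : ℝ × ℝ :=
  (projIcc (0 : ℝ) 1 zero_le_one x.1, projIcc (0 : ℝ) 1 zero_le_one x.2)

theorem clampSquare_mem (x : ℝ × ℝ) : clampSquare x ∈ Icc (0 : ℝ) 1 ×ˢ Icc (0 : ℝ) 1 :=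
  ⟨Subtype.coe_prop _, Subtype.coe_prop _⟩

theorem clampSquare_of_mem {x : ℝ × ℝ} (hx : x ∈ Icc (0 : ℝ) 1 ×ˢ Icc (0 : ℝ) 1) :
    clampSquare x = x := by
  simp [clampSquare, projIcc_of_mem _ hx.1, projIcc_of_mem _ hx.2]

theorem lipschitzWith_clampSquare : LipschitzWith 1 clampSquare := by
  unfold clampSquare
  have h : LipschitzWith 1 fun t : ℝ ↦ (projIcc (0 : ℝ) 1 zero_le_one t : ℝ) := by
    simpa [Function.comp_def] using
      (LipschitzWith.subtype_val _).comp (LipschitzWith.projIcc zero_le_one)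
  simpa using (h.comp LipschitzWith.prod_fst).prodMk (h.comp LipschitzWith.prod_snd)

theorem projIcc_mul_one_sub_eq_zero {t : ℝ} (ht : t ∉ Ioo (0 : ℝ) 1) :
    (projIcc (0 : ℝ) 1 zero_le_one t : ℝ) * (1 - projIcc (0 : ℝ) 1 zero_le_one t) = 0 := by
  rcases le_or_gt t 0 with h | h
  · simp [projIcc_of_le_left _ h]
  · simp [projIcc_of_right_le _ (not_lt.1 fun h' ↦ ht ⟨h, h'⟩)]

/-- Solutions of the coupled skill–delegation ODE exist globally in the unit square. -/
theorem exists_skillDelegation_solution (θa κ Δ : ℝ) {x₀ : ℝ × ℝ}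
    (h0 : x₀ ∈ Icc (0 : ℝ) 1 ×ˢ Icc (0 : ℝ) 1) :
    ∃ x : ℝ → ℝ × ℝ, x 0 = x₀ ∧
      (∀ t ∈ Ici (0 : ℝ),
        HasDerivWithinAt x (skillDelegationField θa κ Δ (x t)) (Ici 0) t) ∧
      ∀ t ∈ Ici (0 : ℝ), x t ∈ Icc (0 : ℝ) 1 ×ˢ Icc (0 : ℝ) 1 := by
  have hloc := locallyLipschitz_skillDelegationField θa κ Δ
  have hcpt : IsCompact (Icc (0 : ℝ) 1 ×ˢ Icc (0 : ℝ) 1) := isCompact_Icc.prod isCompact_Icc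
  obtain ⟨K, hK⟩ := hloc.locallyLipschitzOn.exists_lipschitzOnWith_of_compact hcpt
  obtain ⟨L, hL⟩ := hcpt.exists_bound_of_continuousOn hloc.continuous.continuousOn
  have hlip : LipschitzWith (K * 1) (skillDelegationField θa κ Δ ∘ clampSquare) :=
    lipschitzOnWith_univ.1 <| hK.comp lipschitzWith_clampSquare.lipschitzOnWith
      fun x _ ↦ clampSquare_mem x
  obtain ⟨x, hx0, hx⟩ := hlip.exists_hasDerivWithinAt_Ici (L := L.toNNReal)
    (fun y ↦ (hL _ (clampSquare_mem y)).trans (Real.le_coe_toNNReal L)) x₀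
  have hmem : ∀ t ∈ Ici (0 : ℝ), x t ∈ Icc (0 : ℝ) 1 ×ˢ Icc (0 : ℝ) 1 := by
    refine fun t ht ↦ ⟨?_, ?_⟩
    · refine mem_Icc_of_hasDerivWithinAt_eq_zero (f := fun s ↦ (x s).1)
        (fun s hs ↦ (hx s hs).fst) (by simpa [hx0] using h0.1) (fun s _ h ↦ ?_) ht
      simp only [Function.comp_apply, skillDelegationField, clampSquare,
        projIcc_mul_one_sub_eq_zero h, zero_mul]
    · refine mem_Icc_of_hasDerivWithinAt_eq_zero (f := fun s ↦ (x s).2)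
        (fun s hs ↦ (hx s hs).snd) (by simpa [hx0] using h0.2) (fun s _ h ↦ ?_) ht
      simp only [Function.comp_apply, skillDelegationField, clampSquare, mul_assoc κ,
        projIcc_mul_one_sub_eq_zero h, zero_mul, mul_zero]
  refine ⟨x, hx0, fun t ht ↦ ?_, hmem⟩
  simpa [clampSquare_of_mem (hmem t ht)] using hx t ht

/-- Global existence, uniqueness and forward invariance of `[0,1]²` for the
coupled skill–delegation ODE
`θ' = θ(1-θ)((1-p)(1-θ) - Δpθ)`, `p' = κ p(1-p)((1-θ)² - (1-θa)²)`. -/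
theorem coupled_ode_existence_uniqueness_invariance
    (θa κ Δ : ℝ) (hθa : θa ∈ Ioo (0:ℝ) 1) (hκ : 0 < κ) (hΔ : 0 < Δ)
    (θ0 p0 : ℝ) (h0 : (θ0, p0) ∈ Icc (0:ℝ) 1 ×ˢ Icc (0:ℝ) 1) :
    ∃ θ p : ℝ → ℝ,
      (θ 0 = θ0 ∧ p 0 = p0 ∧
        ∀ t ∈ Ici (0:ℝ),
          HasDerivWithinAt θ
            (θ t * (1 - θ t) * ((1 - p t) * (1 - θ t) - Δ * p t * θ t)) (Ici 0) t ∧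
          HasDerivWithinAt p
            (κ * p t * (1 - p t) * ((1 - θ t) ^ 2 - (1 - θa) ^ 2)) (Ici 0) t) ∧
      (∀ t ∈ Ici (0:ℝ), θ t ∈ Icc (0:ℝ) 1 ∧ p t ∈ Icc (0:ℝ) 1) ∧
      (∀ θ' p' : ℝ → ℝ,
        (θ' 0 = θ0 ∧ p' 0 = p0 ∧
          ∀ t ∈ Ici (0:ℝ),
            HasDerivWithinAt θ'
              (θ' t * (1 - θ' t) * ((1 - p' t) * (1 - θ' t) - Δ * p' t * θ' t)) (Ici 0) t ∧
            HasDerivWithinAt p'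
              (κ * p' t * (1 - p' t) * ((1 - θ' t) ^ 2 - (1 - θa) ^ 2)) (Ici 0) t) →
        ∀ t ∈ Ici (0:ℝ), θ' t = θ t ∧ p' t = p t) := by
  obtain ⟨x, hx0, hx, hmem⟩ := exists_skillDelegation_solution θa κ Δ h0
  refine ⟨fun t ↦ (x t).1, fun t ↦ (x t).2,
    ⟨by simp [hx0], by simp [hx0], fun t ht ↦ ⟨(hx t ht).fst, (hx t ht).snd⟩⟩, hmem, ?_⟩
  rintro θ' p' ⟨hθ0, hp0, hd⟩ t ht
  exact Prod.ext_iff.1 <| (locallyLipschitz_skillDelegationField θa κ Δ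
    ).eqOn_Ici_of_hasDerivWithinAt (x := fun t ↦ (θ' t, p' t))
      (fun s hs ↦ (hd s hs).1.prodMk (hd s hs).2) hx (by simp [hx0, hθ0, hp0]) ht
end

section
/- For the planar ODE θ' = θ(1−θ)((1−p)(1−θ) − Δpθ), p' = κ p(1−p)((1−θ)² − (1−θ_a)²) with θ_a ∈ (0,1), κ > 0, Δ > 0, every solution with initial condition in [0,1]² converges as t → ∞: there exists (θ^∞, p^∞) ∈ [0,1]² such that lim_{t→∞} (θ(t), p(t)) = (θ^∞, p^∞). -/
open Set Filter

theorem HasDerivWithinAt.min_zero_sq {f : ℝ → ℝ} {f' t : ℝ} {s : Set ℝ}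
    (hf : HasDerivWithinAt f f' s t) :
    HasDerivWithinAt (fun x => min (f x) 0 ^ 2) (2 * min (f t) 0 * f') s t := by
  have key : ∀ x : ℝ, HasDerivAt (fun y : ℝ => min y 0 ^ 2) (2 * min x 0) x := by
    intro x
    rw [hasDerivAt_iff_isLittleO]
    refine (Asymptotics.IsBigO.of_bound 1 (Eventually.of_forall fun y => ?_)).trans_isLittleO
      (g := fun y : ℝ => (y - x) ^ 2) ?_
    · simp only [smul_eq_mul, Real.norm_eq_abs, abs_pow, sq_abs, one_mul]
      rw [abs_le]
      rcases min_cases y 0 with ⟨hy, hy'⟩ | ⟨hy, hy'⟩ <;>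
        rcases min_cases x 0 with ⟨hx, hx'⟩ | ⟨hx, hx'⟩ <;> rw [hx, hy] <;>
        constructor <;> nlinarith
    · simpa using Asymptotics.isLittleO_pow_sub_sub x one_lt_two
  exact (key (f t)).comp_hasDerivWithinAt t hf

/-- The nonnegative quadrant is forward invariant under a planar linear system whose off-diagonal
coefficients are nonnegative. -/
theorem nonneg_of_cooperative {a b α β γ δ : ℝ → ℝ} {s : ℝ}
    (hα : ContinuousOn α (Ici s)) (hβ : ContinuousOn β (Ici s))
    (hγ : ContinuousOn γ (Ici s)) (hδ : ContinuousOn δ (Ici s))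
    (hβ0 : ∀ t ∈ Ici s, 0 ≤ β t) (hγ0 : ∀ t ∈ Ici s, 0 ≤ γ t)
    (ha : ∀ t ∈ Ici s, HasDerivWithinAt a (α t * a t + β t * b t) (Ici s) t)
    (hb : ∀ t ∈ Ici s, HasDerivWithinAt b (γ t * a t + δ t * b t) (Ici s) t)
    (ha0 : 0 ≤ a s) (hb0 : 0 ≤ b s) :
    ∀ t ∈ Ici s, 0 ≤ a t ∧ 0 ≤ b t := by
  intro T hT
  have hsub : Icc s T ⊆ Ici s := Icc_subset_Ici_self
  have hcont : ContinuousOn (fun t => 2 * |α t| + 2 * |δ t| + β t + γ t) (Icc s T) :=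
    ((((hα.abs.const_mul 2).add (hδ.abs.const_mul 2)).add hβ).add hγ).mono hsub
  obtain ⟨C, hC⟩ := isCompact_Icc.bddAbove_image hcont
  have hC' : ∀ t ∈ Icc s T, 2 * |α t| + 2 * |δ t| + β t + γ t ≤ C :=
    fun t ht => hC (mem_image_of_mem _ ht)
  have hderiv : ∀ t ∈ Icc s T, HasDerivWithinAt
      (fun t => Real.exp (-C * t) * (min (a t) 0 ^ 2 + min (b t) 0 ^ 2))
      (Real.exp (-C * t) * (2 * min (a t) 0 * (α t * a t + β t * b t) +
        2 * min (b t) 0 * (γ t * a t + δ t * b t) -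
          C * (min (a t) 0 ^ 2 + min (b t) 0 ^ 2))) (Icc s T) t := by
    intro t ht
    have h1 : HasDerivAt (fun t => Real.exp (-C * t)) (Real.exp (-C * t) * (-C)) t := by
      simpa using ((hasDerivAt_id t).const_mul (-C)).exp
    have h2 := ((ha t (hsub ht)).mono hsub).min_zero_sq.add
      ((hb t (hsub ht)).mono hsub).min_zero_sq
    exact (h1.hasDerivWithinAt.mul h2).congr_deriv (by simp only [Pi.add_apply]; ring)
  have hanti : AntitoneOn
      (fun t => Real.exp (-C * t) * (min (a t) 0 ^ 2 + min (b t) 0 ^ 2)) (Icc s T) := by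
    refine antitoneOn_of_hasDerivWithinAt_nonpos (convex_Icc s T)
      (fun t ht => (hderiv t ht).continuousWithinAt)
      (fun t ht => (hderiv t (interior_subset ht)).mono interior_subset) fun t ht => ?_
    have ht := interior_subset ht
    refine mul_nonpos_of_nonneg_of_nonpos (Real.exp_pos _).le ?_
    have hβt := hβ0 t (hsub ht)
    have hγt := hγ0 t (hsub ht)
    have hx : min (a t) 0 * a t = min (a t) 0 ^ 2 := by
      rcases min_cases (a t) 0 with ⟨h, -⟩ | ⟨h, -⟩ <;> rw [h] <;> ring
    have hy : min (b t) 0 * b t = min (b t) 0 ^ 2 := by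
      rcases min_cases (b t) 0 with ⟨h, -⟩ | ⟨h, -⟩ <;> rw [h] <;> ring
    have hxb : min (a t) 0 * b t ≤ min (a t) 0 * min (b t) 0 :=
      mul_le_mul_of_nonpos_left (min_le_left _ _) (min_le_right _ _)
    have hya : min (b t) 0 * a t ≤ min (a t) 0 * min (b t) 0 := by
      rw [mul_comm (min (a t) 0)]
      exact mul_le_mul_of_nonpos_left (min_le_left _ _) (min_le_right _ _)
    set x := min (a t) 0
    set y := min (b t) 0
    have hxy : 2 * (x * y) ≤ x ^ 2 + y ^ 2 := by nlinarith [sq_nonneg (x - y)]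
    have e1 := mul_le_mul_of_nonneg_left (hxb.trans (by linarith : x * y ≤ (x ^ 2 + y ^ 2) / 2)) hβt
    have e2 := mul_le_mul_of_nonneg_left (hya.trans (by linarith : x * y ≤ (x ^ 2 + y ^ 2) / 2)) hγt
    have e3 := mul_le_mul_of_nonneg_right (le_abs_self (α t)) (sq_nonneg x)
    have e4 := mul_le_mul_of_nonneg_right (le_abs_self (δ t)) (sq_nonneg y)
    have e5 := mul_le_mul_of_nonneg_right (hC' t ht) (add_nonneg (sq_nonneg x) (sq_nonneg y))
    have e6 := mul_nonneg (abs_nonneg (α t)) (sq_nonneg y)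
    have e7 := mul_nonneg (abs_nonneg (δ t)) (sq_nonneg x)
    have e8 : 2 * x * (α t * a t + β t * b t) + 2 * y * (γ t * a t + δ t * b t) =
        2 * α t * x ^ 2 + 2 * (β t * (x * b t)) + 2 * (γ t * (y * a t)) + 2 * δ t * y ^ 2 := by
      rw [← hx, ← hy]; ring
    rw [e8]
    linarith
  have hle := hanti (left_mem_Icc.2 hT) (right_mem_Icc.2 hT) hT
  simp only [min_eq_right ha0, min_eq_right hb0] at hle
  have hV : min (a T) 0 ^ 2 + min (b T) 0 ^ 2 ≤ 0 := by
    refine nonpos_of_mul_nonpos_right (hle.trans_eq (by ring)) (Real.exp_pos _)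
  have h1 : min (a T) 0 = 0 := by
    nlinarith [sq_nonneg (min (a T) 0), sq_nonneg (min (b T) 0)]
  have h2 : min (b T) 0 = 0 := by
    nlinarith [sq_nonneg (min (a T) 0), sq_nonneg (min (b T) 0)]
  exact ⟨min_eq_right_iff.1 h1, min_eq_right_iff.1 h2⟩

theorem nonneg_of_hasDerivWithinAt_mul_self {f g : ℝ → ℝ} {s : ℝ}
    (hg : ContinuousOn g (Ici s))
    (hf : ∀ t ∈ Ici s, HasDerivWithinAt f (g t * f t) (Ici s) t) (hf0 : 0 ≤ f s) :
    ∀ t ∈ Ici s, 0 ≤ f t := fun t ht =>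
  (nonneg_of_cooperative (b := fun _ => 0) (β := fun _ => 0) (γ := fun _ => 0) (δ := fun _ => 0)
    hg continuousOn_const continuousOn_const continuousOn_const (fun _ _ => le_rfl)
    (fun _ _ => le_rfl) (fun t ht => by simpa using hf t ht)
    (fun t _ => by simpa using hasDerivWithinAt_const t (Ici s) (0 : ℝ)) hf0 le_rfl t ht).1

theorem MonotoneOn.exists_tendsto_Icc {f : ℝ → ℝ} {s c d : ℝ} (hf : MonotoneOn f (Ici s))
    (hmem : ∀ t ∈ Ici s, f t ∈ Icc c d) : ∃ l ∈ Icc c d, Tendsto f atTop (nhds l) := by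
  have hmono : Monotone fun t => f (max t s) := fun x y hxy =>
    hf (mem_Ici.2 (le_max_right _ _)) (mem_Ici.2 (le_max_right _ _)) (max_le_max_right s hxy)
  have hbdd : BddAbove (range fun t => f (max t s)) :=
    ⟨d, by rintro _ ⟨t, rfl⟩; exact (hmem _ (mem_Ici.2 (le_max_right _ _))).2⟩
  have hlim : Tendsto f atTop (nhds (⨆ t, f (max t s))) :=
    (tendsto_atTop_ciSup hmono hbdd).congr' <| by
      filter_upwards [eventually_ge_atTop s] with t ht
      rw [max_eq_left ht]
  exact ⟨_, isClosed_Icc.mem_of_tendsto hlim ((eventually_ge_atTop s).mono hmem), hlim⟩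

theorem exists_tendsto_of_deriv_nonneg {f f' : ℝ → ℝ} {s c d : ℝ}
    (hf : ∀ t ∈ Ici s, HasDerivWithinAt f (f' t) (Ici s) t) (hf' : ∀ t ∈ Ici s, 0 ≤ f' t)
    (hmem : ∀ t ∈ Ici s, f t ∈ Icc c d) : ∃ l ∈ Icc c d, Tendsto f atTop (nhds l) :=
  (monotoneOn_of_hasDerivWithinAt_nonneg (convex_Ici s)
    (fun t ht => (hf t ht).continuousWithinAt)
    (fun t ht => (hf t (interior_subset ht)).mono interior_subset)
    (fun t ht => hf' t (interior_subset ht))).exists_tendsto_Icc hmem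

theorem exists_tendsto_of_deriv_nonpos {f f' : ℝ → ℝ} {s c d : ℝ}
    (hf : ∀ t ∈ Ici s, HasDerivWithinAt f (f' t) (Ici s) t) (hf' : ∀ t ∈ Ici s, f' t ≤ 0)
    (hmem : ∀ t ∈ Ici s, f t ∈ Icc c d) : ∃ l ∈ Icc c d, Tendsto f atTop (nhds l) := by
  obtain ⟨l, hl, hlim⟩ := exists_tendsto_of_deriv_nonneg (c := -d) (d := -c)
    (fun t ht => (hf t ht).neg) (fun t ht => neg_nonneg.2 (hf' t ht))
    (fun t ht => ⟨neg_le_neg (hmem t ht).2, neg_le_neg (hmem t ht).1⟩)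
  exact ⟨-l, ⟨le_neg_of_le_neg hl.2, neg_le_of_neg_le hl.1⟩, by simpa using hlim.neg⟩

/-- Every solution of the coupled skill–delegation ODE starting in `[0,1]²`
converges to some limit `(θ∞, p∞) ∈ [0,1]²` as `t → ∞`. -/
theorem coupled_ode_convergence
    (θa κ Δ : ℝ) (hθa : θa ∈ Ioo (0:ℝ) 1) (hκ : 0 < κ) (hΔ : 0 < Δ)
    (θ p : ℝ → ℝ)
    (h0 : (θ 0, p 0) ∈ Icc (0:ℝ) 1 ×ˢ Icc (0:ℝ) 1)
    (hode : ∀ t ∈ Ici (0:ℝ),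
      HasDerivWithinAt θ
        (θ t * (1 - θ t) * ((1 - p t) * (1 - θ t) - Δ * p t * θ t)) (Ici 0) t ∧
      HasDerivWithinAt p
        (κ * p t * (1 - p t) * ((1 - θ t) ^ 2 - (1 - θa) ^ 2)) (Ici 0) t) :
    ∃ q ∈ Icc (0:ℝ) 1 ×ˢ Icc (0:ℝ) 1,
      Tendsto (fun t => (θ t, p t)) atTop (nhds q) := by
  obtain ⟨⟨hθ0, hθ1⟩, hp0, hp1⟩ := h0
  have hθc : ContinuousOn θ (Ici 0) := fun t ht => (hode t ht).1.continuousWithinAt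
  have hpc : ContinuousOn p (Ici 0) := fun t ht => (hode t ht).2.continuousWithinAt
  have hθnn : ∀ t ∈ Ici (0:ℝ), 0 ≤ θ t := nonneg_of_hasDerivWithinAt_mul_self
    (g := fun t => (1 - θ t) * ((1 - p t) * (1 - θ t) - Δ * p t * θ t)) (by fun_prop)
    (fun t ht => (hode t ht).1.congr_deriv (by ring)) hθ0
  have hθle : ∀ t ∈ Ici (0:ℝ), 0 ≤ 1 - θ t := nonneg_of_hasDerivWithinAt_mul_self
    (g := fun t => -(θ t * ((1 - p t) * (1 - θ t) - Δ * p t * θ t))) (by fun_prop)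
    (fun t ht => ((hode t ht).1.const_sub 1).congr_deriv (by ring)) (sub_nonneg.2 hθ1)
  have hpnn : ∀ t ∈ Ici (0:ℝ), 0 ≤ p t := nonneg_of_hasDerivWithinAt_mul_self
    (g := fun t => κ * (1 - p t) * ((1 - θ t) ^ 2 - (1 - θa) ^ 2)) (by fun_prop)
    (fun t ht => (hode t ht).2.congr_deriv (by ring)) hp0
  have hple : ∀ t ∈ Ici (0:ℝ), 0 ≤ 1 - p t := nonneg_of_hasDerivWithinAt_mul_self
    (g := fun t => -(κ * p t * ((1 - θ t) ^ 2 - (1 - θa) ^ 2))) (by fun_prop)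
    (fun t ht => ((hode t ht).2.const_sub 1).congr_deriv (by ring)) (sub_nonneg.2 hp1)
  set a : ℝ → ℝ := fun t => (1 - p t) * (1 - θ t) - Δ * p t * θ t with ha
  set b : ℝ → ℝ := fun t => (1 - θ t) ^ 2 - (1 - θa) ^ 2 with hb
  set α : ℝ → ℝ := fun t => -((1 - p t + Δ * p t) * (θ t * (1 - θ t))) with hα
  set β : ℝ → ℝ := fun t => (1 - θ t + Δ * θ t) * (κ * p t * (1 - p t)) with hβ
  set γ : ℝ → ℝ := fun t => 2 * (1 - θ t) * (θ t * (1 - θ t)) with hγ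
  have hac : ContinuousOn a (Ici 0) := by fun_prop
  have hαc : ContinuousOn α (Ici 0) := by fun_prop
  have hβc : ContinuousOn β (Ici 0) := by fun_prop
  have hγc : ContinuousOn γ (Ici 0) := by fun_prop
  have hβ0 : ∀ t ∈ Ici (0:ℝ), 0 ≤ β t := fun t ht =>
    mul_nonneg (add_nonneg (hθle t ht) (mul_nonneg hΔ.le (hθnn t ht)))
      (mul_nonneg (mul_nonneg hκ.le (hpnn t ht)) (hple t ht))
  have hγ0 : ∀ t ∈ Ici (0:ℝ), 0 ≤ γ t := fun t ht =>
    mul_nonneg (mul_nonneg zero_le_two (hθle t ht)) (mul_nonneg (hθnn t ht) (hθle t ht))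
  have had : ∀ t ∈ Ici (0:ℝ), HasDerivWithinAt a (α t * a t - β t * b t) (Ici 0) t := by
    intro t ht
    obtain ⟨h1, h2⟩ := hode t ht
    exact (((h2.const_sub 1).mul (h1.const_sub 1)).sub ((h2.const_mul Δ).mul h1)).congr_deriv
      (by simp only [hα, hβ, ha, hb]; ring)
  have hbd : ∀ t ∈ Ici (0:ℝ), HasDerivWithinAt b (-(γ t * a t)) (Ici 0) t := by
    intro t ht
    exact ((((hode t ht).1.const_sub 1).pow 2).sub_const ((1 - θa) ^ 2)).congr_deriv
      (by simp only [hγ, ha]; push_cast; ring)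
  have hmemθ : ∀ t ∈ Ici (0:ℝ), θ t ∈ Icc (0:ℝ) 1 := fun t ht =>
    ⟨hθnn t ht, sub_nonneg.1 (hθle t ht)⟩
  have hmemp : ∀ t ∈ Ici (0:ℝ), p t ∈ Icc (0:ℝ) 1 := fun t ht =>
    ⟨hpnn t ht, sub_nonneg.1 (hple t ht)⟩
  have hwθ : ∀ t ∈ Ici (0:ℝ), 0 ≤ θ t * (1 - θ t) := fun t ht =>
    mul_nonneg (hθnn t ht) (hθle t ht)
  have hwp : ∀ t ∈ Ici (0:ℝ), 0 ≤ κ * p t * (1 - p t) := fun t ht =>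
    mul_nonneg (mul_nonneg hκ.le (hpnn t ht)) (hple t ht)
  -- It suffices that `a` and `b` eventually have constant signs.
  suffices h : ∃ s ∈ Ici (0:ℝ), ((∀ t ∈ Ici s, 0 ≤ a t) ∨ ∀ t ∈ Ici s, a t ≤ 0) ∧
      ((∀ t ∈ Ici s, 0 ≤ b t) ∨ ∀ t ∈ Ici s, b t ≤ 0) by
    obtain ⟨s, hs, hsa, hsb⟩ := h
    have hsub : Ici s ⊆ Ici 0 := Ici_subset_Ici.2 hs
    have hθd := fun t (ht : t ∈ Ici s) => (hode t (hsub ht)).1.mono hsub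
    have hpd := fun t (ht : t ∈ Ici s) => (hode t (hsub ht)).2.mono hsub
    have hmθ := fun t (ht : t ∈ Ici s) => hmemθ t (hsub ht)
    have hmp := fun t (ht : t ∈ Ici s) => hmemp t (hsub ht)
    have hθlim : ∃ l ∈ Icc (0:ℝ) 1, Tendsto θ atTop (nhds l) := by
      rcases hsa with h | h
      · exact exists_tendsto_of_deriv_nonneg hθd
          (fun t ht => mul_nonneg (hwθ t (hsub ht)) (h t ht)) hmθ
      · exact exists_tendsto_of_deriv_nonpos hθd
          (fun t ht => mul_nonpos_of_nonneg_of_nonpos (hwθ t (hsub ht)) (h t ht)) hmθ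
    have hplim : ∃ l ∈ Icc (0:ℝ) 1, Tendsto p atTop (nhds l) := by
      rcases hsb with h | h
      · exact exists_tendsto_of_deriv_nonneg hpd
          (fun t ht => mul_nonneg (hwp t (hsub ht)) (h t ht)) hmp
      · exact exists_tendsto_of_deriv_nonpos hpd
          (fun t ht => mul_nonpos_of_nonneg_of_nonpos (hwp t (hsub ht)) (h t ht)) hmp
    obtain ⟨x, hx, hxlim⟩ := hθlim
    obtain ⟨y, hy, hylim⟩ := hplim
    exact ⟨(x, y), ⟨hx, hy⟩, hxlim.prodMk_nhds hylim⟩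
  by_cases h1 : ∃ s ∈ Ici (0:ℝ), 0 ≤ a s ∧ b s ≤ 0
  · obtain ⟨s, hs, has, hbs⟩ := h1
    have hsub : Ici s ⊆ Ici 0 := Ici_subset_Ici.2 hs
    have key := nonneg_of_cooperative (b := fun t => -b t) (δ := fun _ => 0) (hαc.mono hsub)
      (hβc.mono hsub) (hγc.mono hsub) continuousOn_const (fun t ht => hβ0 t (hsub ht))
      (fun t ht => hγ0 t (hsub ht))
      (fun t ht => ((had t (hsub ht)).mono hsub).congr_deriv (by ring))
      (fun t ht => ((hbd t (hsub ht)).mono hsub).neg.congr_deriv (by ring)) has (neg_nonneg.2 hbs)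
    exact ⟨s, hs, Or.inl fun t ht => (key t ht).1, Or.inr fun t ht => neg_nonneg.1 (key t ht).2⟩
  by_cases h2 : ∃ s ∈ Ici (0:ℝ), a s ≤ 0 ∧ 0 ≤ b s
  · obtain ⟨s, hs, has, hbs⟩ := h2
    have hsub : Ici s ⊆ Ici 0 := Ici_subset_Ici.2 hs
    have key := nonneg_of_cooperative (a := fun t => -a t) (δ := fun _ => 0) (hαc.mono hsub)
      (hβc.mono hsub) (hγc.mono hsub) continuousOn_const (fun t ht => hβ0 t (hsub ht))
      (fun t ht => hγ0 t (hsub ht))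
      (fun t ht => ((had t (hsub ht)).mono hsub).neg.congr_deriv (by ring))
      (fun t ht => ((hbd t (hsub ht)).mono hsub).congr_deriv (by ring)) (neg_nonneg.2 has) hbs
    exact ⟨s, hs, Or.inr fun t ht => neg_nonneg.1 (key t ht).1, Or.inl fun t ht => (key t ht).2⟩
  push Not at h1 h2
  have hne : ∀ t ∈ Ici (0:ℝ), a t ≠ 0 := fun t ht h =>
    lt_asymm (h1 t ht h.ge) (h2 t ht h.le)
  have hsign : (∀ t ∈ Ici (0:ℝ), 0 ≤ a t) ∨ ∀ t ∈ Ici (0:ℝ), a t ≤ 0 := by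
    by_contra! hcon
    obtain ⟨⟨t, ht, hat⟩, u, hu, hau⟩ := hcon
    obtain ⟨v, hv, hav⟩ := isPreconnected_Ici.intermediate_value ht hu hac ⟨hat.le, hau.le⟩
    exact hne v hv hav
  refine ⟨0, self_mem_Ici, hsign, ?_⟩
  rcases hsign with h | h
  · exact Or.inl fun t ht => (h1 t ht (h t ht)).le
  · exact Or.inr fun t ht => (h2 t ht (h t ht)).le
end

section
/- Fix θ_a ∈ (0,1), κ > 0, Δ > 0 and consider solutions of the ODE θ' = θ(1−θ)((1−p)(1−θ) − Δpθ), p' = κ p(1−p)((1−θ)² − (1−θ_a)²) in [0,1]². If two initial conditions satisfy θ₀ ≤ θ̂₀ and p₀ ≥ p̂₀, then for all t ≥ 0 the corresponding solutions satisfy θ(t; θ₀, p₀) ≤ θ(t; θ̂₀, p̂₀) and p(t; θ₀, p₀) ≥ p(t; θ̂₀, p̂₀). In particular, for fixed θ₀, the skill θ(t; θ₀, p₀) is non-increasing in the initial delegation p₀ and the delegation p(t; θ₀, p₀) is non-decreasing in p₀; and for fixed p₀, θ(t; θ₀, p₀) is non-decreasing in θ₀ and p(t; θ₀, p₀) is non-increasing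 in θ₀. -/
open Set

/-- The square of the negative part is differentiable. -/
lemma hasDerivAt_min_zero_sq (x : ℝ) :
    HasDerivAt (fun y : ℝ => (min y 0) ^ 2) (2 * min x 0) x := by
  rcases lt_trichotomy x 0 with hx | rfl | hx
  · rw [min_eq_left hx.le]
    have h : HasDerivAt (fun y : ℝ => y ^ 2) (2 * x) x := by
      simpa using hasDerivAt_pow 2 x
    refine h.congr_of_eventuallyEq ?_
    filter_upwards [Iio_mem_nhds hx] with y hy
    rw [min_eq_left (le_of_lt hy)]
  · rw [hasDerivAt_iff_isLittleO]
    have h : (fun y : ℝ => y ^ 2) =o[nhds 0] fun y : ℝ => y := by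
      simpa using Asymptotics.isLittleO_pow_pow (𝕜 := ℝ) one_lt_two
    refine (Asymptotics.IsBigO.of_bound 1 (Filter.Eventually.of_forall fun y => ?_)).trans_isLittleO
      (by simpa using h)
    rcases le_total y 0 with hy | hy <;> simp [hy]
  · rw [min_eq_right hx.le, mul_zero]
    refine (hasDerivAt_const x (0 : ℝ)).congr_of_eventuallyEq ?_
    filter_upwards [Ioi_mem_nhds hx] with y hy
    simp [min_eq_right (le_of_lt (mem_Ioi.1 hy))]

/-- A planar linear system with continuous coefficients and nonnegative off-diagonal entries
preserves the closed positive quadrant. -/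
lemma nonneg_of_cooperative_linear_system {u v a b c d : ℝ → ℝ}
    (ha : ContinuousOn a (Ici 0)) (hb : ContinuousOn b (Ici 0))
    (hc : ContinuousOn c (Ici 0)) (hd : ContinuousOn d (Ici 0))
    (hb0 : ∀ t ∈ Ici (0 : ℝ), 0 ≤ b t) (hc0 : ∀ t ∈ Ici (0 : ℝ), 0 ≤ c t)
    (hu : ∀ t ∈ Ici (0 : ℝ), HasDerivWithinAt u (a t * u t + b t * v t) (Ici 0) t)
    (hv : ∀ t ∈ Ici (0 : ℝ), HasDerivWithinAt v (c t * u t + d t * v t) (Ici 0) t)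
    (hu0 : 0 ≤ u 0) (hv0 : 0 ≤ v 0) :
    ∀ t ∈ Ici (0 : ℝ), 0 ≤ u t ∧ 0 ≤ v t := by
  intro T hT
  have hsub : Icc 0 T ⊆ Ici (0 : ℝ) := Icc_subset_Ici_self
  obtain ⟨K, hK⟩ := (isCompact_Icc (a := (0 : ℝ)) (b := T)).exists_bound_of_continuousOn
    (f := fun t => |a t| + |b t| + |c t| + |d t|)
    ((((ha.abs.add hb.abs).add hc.abs).add hd.abs).mono hsub)
  set E : ℝ → ℝ := fun t => (min (u t) 0) ^ 2 + (min (v t) 0) ^ 2 with hE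
  have hE' : ∀ t ∈ Ici (0 : ℝ), HasDerivWithinAt E
      (2 * min (u t) 0 * (a t * u t + b t * v t) +
        2 * min (v t) 0 * (c t * u t + d t * v t)) (Ici 0) t := fun t ht =>
    ((hasDerivAt_min_zero_sq (u t)).comp_hasDerivWithinAt t (hu t ht)).add
      ((hasDerivAt_min_zero_sq (v t)).comp_hasDerivWithinAt t (hv t ht))
  have hexp : ∀ t, HasDerivAt (fun s => Real.exp (-(2 * K) * s))
      (Real.exp (-(2 * K) * t) * (-(2 * K))) t := fun t => by
    simpa using ((hasDerivAt_id t).const_mul (-(2 * K))).exp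
  have hanti : AntitoneOn (fun t => E t * Real.exp (-(2 * K) * t)) (Icc 0 T) := by
    refine antitoneOn_of_hasDerivWithinAt_nonpos (convex_Icc 0 T)
      (fun t ht => ((hE' t (hsub ht)).mul
        (hexp t).hasDerivWithinAt).continuousWithinAt.mono hsub)
      (fun t ht => ((hE' t (hsub (interior_subset ht))).mul
        (hexp t).hasDerivWithinAt).mono (interior_subset.trans hsub)) fun t ht => ?_
    have ht' := interior_subset ht
    have hKt := (le_abs_self _).trans (hK t ht')
    have hbt := hb0 t (hsub ht')
    have hct := hc0 t (hsub ht')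
    rw [abs_of_nonneg hbt, abs_of_nonneg hct] at hKt
    have key : 2 * min (u t) 0 * (a t * u t + b t * v t) +
        2 * min (v t) 0 * (c t * u t + d t * v t) ≤ 2 * K * E t := by
      have hmin : ∀ x : ℝ, min x 0 * x = min x 0 ^ 2 := fun x => by
        rcases le_total x 0 with h | h <;> simp [h, sq]
      have hx := min_le_right (u t) 0
      have hy := min_le_right (v t) 0
      have hxu := min_le_left (u t) 0
      have hyv := min_le_left (v t) 0
      have h1 := hmin (u t)
      have h2 := hmin (v t)
      simp only [hE]
      generalize min (u t) 0 = x at *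
      generalize min (v t) 0 = y at *
      have e1 : b t * (x * v t) ≤ b t * (x * y) :=
        mul_le_mul_of_nonneg_left (mul_le_mul_of_nonpos_left hyv hx) hbt
      have e2 : c t * (y * u t) ≤ c t * (y * x) :=
        mul_le_mul_of_nonneg_left (mul_le_mul_of_nonpos_left hxu hy) hct
      have e3 : (b t + c t) * (2 * (x * y)) ≤ (b t + c t) * (x ^ 2 + y ^ 2) :=
        mul_le_mul_of_nonneg_left (by nlinarith [sq_nonneg (x - y)]) (by positivity)
      have e4 : (2 * a t + b t + c t) * x ^ 2 ≤ 2 * K * x ^ 2 :=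
        mul_le_mul_of_nonneg_right
          (by linarith [le_abs_self (a t), abs_nonneg (d t)]) (sq_nonneg x)
      have e5 : (2 * d t + b t + c t) * y ^ 2 ≤ 2 * K * y ^ 2 :=
        mul_le_mul_of_nonneg_right
          (by linarith [le_abs_self (d t), abs_nonneg (a t)]) (sq_nonneg y)
      linear_combination e1 * 2 + e2 * 2 + e3 + e4 + e5 + 2 * a t * h1 + 2 * d t * h2
    linear_combination Real.exp (-(2 * K) * t) * key
  have hET := hanti (left_mem_Icc.2 hT) (right_mem_Icc.2 hT) hT
  have hE0 : E 0 = 0 := by simp [hE, hu0, hv0]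
  simp only [hE0, zero_mul] at hET
  have hET' : E T ≤ 0 := nonpos_of_mul_nonpos_left hET (Real.exp_pos _)
  simp only [hE] at hET'
  constructor
  · have : min (u T) 0 = 0 := by nlinarith [sq_nonneg (min (u T) 0), sq_nonneg (min (v T) 0)]
    exact min_eq_right_iff.1 this
  · have : min (v T) 0 = 0 := by nlinarith [sq_nonneg (min (u T) 0), sq_nonneg (min (v T) 0)]
    exact min_eq_right_iff.1 this

/-- A scalar linear equation with continuous coefficient preserves nonnegativity. -/
lemma nonneg_of_hasDerivWithinAt_mul {u a : ℝ → ℝ} (ha : ContinuousOn a (Ici 0))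
    (hu : ∀ t ∈ Ici (0 : ℝ), HasDerivWithinAt u (a t * u t) (Ici 0) t) (hu0 : 0 ≤ u 0) :
    ∀ t ∈ Ici (0 : ℝ), 0 ≤ u t := fun t ht =>
  (nonneg_of_cooperative_linear_system (v := fun _ => 0) (b := fun _ => 0) (c := fun _ => 0)
    (d := fun _ => 0) ha continuousOn_const continuousOn_const continuousOn_const
    (fun _ _ => le_rfl) (fun _ _ => le_rfl) (by simpa using hu)
    (fun t _ => by simpa using hasDerivWithinAt_const t (Ici 0) (0 : ℝ)) hu0 le_rfl t ht).1

/-- A solution of a scalar equation of logistic type `x' = x (1 - x) g` which starts in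
`[0, 1]` stays there. -/
lemma mem_Icc_of_hasDerivWithinAt_logistic {x g : ℝ → ℝ} (hg : ContinuousOn g (Ici 0))
    (hx : ∀ t ∈ Ici (0 : ℝ), HasDerivWithinAt x (x t * (1 - x t) * g t) (Ici 0) t)
    (hx0 : x 0 ∈ Icc (0 : ℝ) 1) : ∀ t ∈ Ici (0 : ℝ), x t ∈ Icc (0 : ℝ) 1 := by
  have hxc : ContinuousOn x (Ici 0) := fun t ht => (hx t ht).continuousWithinAt
  intro t ht
  refine ⟨nonneg_of_hasDerivWithinAt_mul (a := fun t => (1 - x t) * g t) (by fun_prop)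
    (fun s hs => (hx s hs).congr_deriv (by ring)) hx0.1 t ht, ?_⟩
  exact sub_nonneg.1 <| nonneg_of_hasDerivWithinAt_mul (u := fun t => 1 - x t)
    (a := fun t => -(x t * g t)) (by fun_prop)
    (fun s hs => ((hx s hs).const_sub 1).congr_deriv (by ring)) (sub_nonneg.2 hx0.2) t ht

/-- Monotone comparison: for two solutions of the coupled skill–delegation ODE
in `[0,1]²`, if the initial conditions satisfy `θ₀ ≤ θ̂₀` and `p₀ ≥ p̂₀`, then
`θ(t) ≤ θ̂(t)` and `p(t) ≥ p̂(t)` for all `t ≥ 0`. -/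
theorem coupled_ode_monotone_comparison
    (θa κ Δ : ℝ) (hθa : θa ∈ Ioo (0:ℝ) 1) (hκ : 0 < κ) (hΔ : 0 < Δ)
    (θ p θh ph : ℝ → ℝ)
    (h0 : (θ 0, p 0) ∈ Icc (0:ℝ) 1 ×ˢ Icc (0:ℝ) 1)
    (h0' : (θh 0, ph 0) ∈ Icc (0:ℝ) 1 ×ˢ Icc (0:ℝ) 1)
    (hode : ∀ t ∈ Ici (0:ℝ),
      HasDerivWithinAt θ
        (θ t * (1 - θ t) * ((1 - p t) * (1 - θ t) - Δ * p t * θ t)) (Ici 0) t ∧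
      HasDerivWithinAt p
        (κ * p t * (1 - p t) * ((1 - θ t) ^ 2 - (1 - θa) ^ 2)) (Ici 0) t)
    (hode' : ∀ t ∈ Ici (0:ℝ),
      HasDerivWithinAt θh
        (θh t * (1 - θh t) * ((1 - ph t) * (1 - θh t) - Δ * ph t * θh t)) (Ici 0) t ∧
      HasDerivWithinAt ph
        (κ * ph t * (1 - ph t) * ((1 - θh t) ^ 2 - (1 - θa) ^ 2)) (Ici 0) t)
    (hθ0 : θ 0 ≤ θh 0) (hp0 : p 0 ≥ ph 0) :
    ∀ t ∈ Ici (0:ℝ), θ t ≤ θh t ∧ p t ≥ ph t := by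
  have hθc : ContinuousOn θ (Ici 0) := fun t ht => (hode t ht).1.continuousWithinAt
  have hpc : ContinuousOn p (Ici 0) := fun t ht => (hode t ht).2.continuousWithinAt
  have hθhc : ContinuousOn θh (Ici 0) := fun t ht => (hode' t ht).1.continuousWithinAt
  have hphc : ContinuousOn ph (Ici 0) := fun t ht => (hode' t ht).2.continuousWithinAt
  have hθ := mem_Icc_of_hasDerivWithinAt_logistic
    (g := fun t => (1 - p t) * (1 - θ t) - Δ * p t * θ t) (by fun_prop)
    (fun t ht => (hode t ht).1) h0.1
  have hθh := mem_Icc_of_hasDerivWithinAt_logistic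
    (g := fun t => (1 - ph t) * (1 - θh t) - Δ * ph t * θh t) (by fun_prop)
    (fun t ht => (hode' t ht).1) h0'.1
  have hph := mem_Icc_of_hasDerivWithinAt_logistic
    (g := fun t => κ * ((1 - θh t) ^ 2 - (1 - θa) ^ 2)) (by fun_prop)
    (fun t ht => (hode' t ht).2.congr_deriv (by ring)) h0'.2
  have key := nonneg_of_cooperative_linear_system
    (u := fun t => θh t - θ t) (v := fun t => p t - ph t)
    (a := fun t => (1 - ph t) *
        (1 - 2 * (θ t + θh t) + (θ t ^ 2 + θ t * θh t + θh t ^ 2)) -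
      Δ * ph t * ((θ t + θh t) - (θ t ^ 2 + θ t * θh t + θh t ^ 2)))
    (b := fun t => θ t * (1 - θ t) * ((1 - θ t) + Δ * θ t))
    (c := fun t => κ * (ph t * (1 - ph t)) * ((1 - θ t) + (1 - θh t)))
    (d := fun t => κ * ((1 - θ t) ^ 2 - (1 - θa) ^ 2) * (1 - p t - ph t))
    (by fun_prop) (by fun_prop) (by fun_prop) (by fun_prop)
    (fun t ht => by
      have h1 := (hθ t ht).1
      have h2 := sub_nonneg.2 (hθ t ht).2
      positivity)
    (fun t ht => by
      have h1 := (hph t ht).1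
      have h2 := sub_nonneg.2 (hph t ht).2
      have h3 := sub_nonneg.2 (hθ t ht).2
      have h4 := sub_nonneg.2 (hθh t ht).2
      positivity)
    (fun t ht => ((hode' t ht).1.sub (hode t ht).1).congr_deriv (by ring))
    (fun t ht => ((hode t ht).2.sub (hode' t ht).2).congr_deriv (by ring))
    (sub_nonneg.2 hθ0) (sub_nonneg.2 hp0)
  exact fun t ht => ⟨sub_nonneg.1 (key t ht).1, sub_nonneg.1 (key t ht).2⟩
end

section
/- Fix θ_a ∈ (0,1), κ > 0, Δ > 0 and θ₀ ∈ (0,1), p₀ ∈ (0,1). Let (θ(t), p(t)) be the solution of θ' = θ(1−θ)((1−p)(1−θ) − Δpθ), p' = κ p(1−p)((1−θ)² − (1−θ_a)²) with initial condition (θ₀, p₀), and let θ̄(t) be the solution of the no-AI baseline θ' = θ(1−θ)² with θ̄(0) = θ₀. Then for all t ≥ 0: p(t) > 0 and θ(t) ≤ θ̄(t). -/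
open Set

/-- Linear differential inequality on `[0, ∞)`: a function with `g * f ≤ f'` stays above a positive
multiple of its initial value. -/
theorem exists_pos_mul_initial_le_of_mul_le_deriv {f f' g : ℝ → ℝ}
    (hf : ∀ t ∈ Ici (0:ℝ), HasDerivWithinAt f (f' t) (Ici 0) t)
    (hg : ContinuousOn g (Ici 0)) (hle : ∀ t ∈ Ici (0:ℝ), g t * f t ≤ f' t)
    {t : ℝ} (ht : 0 ≤ t) : ∃ c : ℝ, 0 < c ∧ c * f 0 ≤ f t := by
  have hcont : Continuous fun s : ℝ => g (max 0 s) :=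
    hg.comp_continuous (by fun_prop) fun s => le_max_left 0 s
  let G : ℝ → ℝ := fun s => ∫ u in (0:ℝ)..s, g (max 0 u)
  have hG : ∀ s ∈ Ici (0:ℝ), HasDerivAt G (g s) s := fun s hs => by
    have h := (hcont.integral_hasStrictDerivAt 0 s).hasDerivAt
    rwa [max_eq_right hs] at h
  have hderiv : ∀ s ∈ Ici (0:ℝ), HasDerivWithinAt (fun s => f s * Real.exp (-G s))
      (f' s * Real.exp (-G s) + f s * (Real.exp (-G s) * -g s)) (Ici 0) s := fun s hs =>
    (hf s hs).mul (hG s hs).neg.exp.hasDerivWithinAt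
  have hmono : MonotoneOn (fun s => f s * Real.exp (-G s)) (Ici 0) := by
    refine monotoneOn_of_hasDerivWithinAt_nonneg (convex_Ici 0)
      (fun s hs => (hderiv s hs).continuousWithinAt)
      (fun s hs => (hderiv s (interior_subset hs)).mono interior_subset) fun s hs => ?_
    have h := mul_nonneg (sub_nonneg.2 (hle s (interior_subset hs))) (Real.exp_pos (-G s)).le
    linarith
  have h := hmono self_mem_Ici ht ht
  have hG0 : G 0 = 0 := intervalIntegral.integral_same
  simp only [hG0, neg_zero, Real.exp_zero, mul_one] at h
  refine ⟨Real.exp (G t), Real.exp_pos _, ?_⟩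
  calc Real.exp (G t) * f 0 ≤ Real.exp (G t) * (f t * Real.exp (-G t)) := by gcongr
    _ = f t * (Real.exp (G t) * Real.exp (-G t)) := by ring
    _ = f t := by rw [← Real.exp_add, add_neg_cancel, Real.exp_zero, mul_one]

theorem pos_of_mul_le_deriv {f f' g : ℝ → ℝ}
    (hf : ∀ t ∈ Ici (0:ℝ), HasDerivWithinAt f (f' t) (Ici 0) t)
    (hg : ContinuousOn g (Ici 0)) (hle : ∀ t ∈ Ici (0:ℝ), g t * f t ≤ f' t)
    (h0 : 0 < f 0) {t : ℝ} (ht : 0 ≤ t) : 0 < f t := by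
  obtain ⟨c, hc, h⟩ := exists_pos_mul_initial_le_of_mul_le_deriv hf hg hle ht
  exact (mul_pos hc h0).trans_le h

theorem nonneg_of_mul_le_deriv {f f' g : ℝ → ℝ}
    (hf : ∀ t ∈ Ici (0:ℝ), HasDerivWithinAt f (f' t) (Ici 0) t)
    (hg : ContinuousOn g (Ici 0)) (hle : ∀ t ∈ Ici (0:ℝ), g t * f t ≤ f' t)
    (h0 : 0 ≤ f 0) {t : ℝ} (ht : 0 ≤ t) : 0 ≤ f t := by
  obtain ⟨c, hc, h⟩ := exists_pos_mul_initial_le_of_mul_le_deriv hf hg hle ht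
  exact (mul_nonneg hc.le h0).trans h

/-- Negative coupling: starting from `(θ0, p0) ∈ (0,1)²`, the AI-assisted
solution keeps a strictly positive delegation level and its skill never
exceeds the no-AI baseline `θ̄' = θ̄(1-θ̄)²` started from the same `θ0`. -/
theorem coupled_ode_delegation_positive_skill_below_baseline
    (θa κ Δ : ℝ) (hθa : θa ∈ Ioo (0:ℝ) 1) (hκ : 0 < κ) (hΔ : 0 < Δ)
    (θ0 p0 : ℝ) (hθ0 : θ0 ∈ Ioo (0:ℝ) 1) (hp0 : p0 ∈ Ioo (0:ℝ) 1)
    (θ p θb : ℝ → ℝ)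
    (hinit : θ 0 = θ0 ∧ p 0 = p0) (hbinit : θb 0 = θ0)
    (hode : ∀ t ∈ Ici (0:ℝ),
      HasDerivWithinAt θ
        (θ t * (1 - θ t) * ((1 - p t) * (1 - θ t) - Δ * p t * θ t)) (Ici 0) t ∧
      HasDerivWithinAt p
        (κ * p t * (1 - p t) * ((1 - θ t) ^ 2 - (1 - θa) ^ 2)) (Ici 0) t)
    (hbode : ∀ t ∈ Ici (0:ℝ),
      HasDerivWithinAt θb (θb t * (1 - θb t) ^ 2) (Ici 0) t) :
    ∀ t ∈ Ici (0:ℝ), 0 < p t ∧ θ t ≤ θb t := by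
  obtain ⟨hθi, hpi⟩ := hinit
  have hθd := fun t ht => (hode t ht).1
  have hpd := fun t ht => (hode t ht).2
  have hθc : ContinuousOn θ (Ici 0) := fun t ht => (hθd t ht).continuousWithinAt
  have hpc : ContinuousOn p (Ici 0) := fun t ht => (hpd t ht).continuousWithinAt
  have hbc : ContinuousOn θb (Ici 0) := fun t ht => (hbode t ht).continuousWithinAt
  have hp_pos : ∀ t ∈ Ici (0:ℝ), 0 < p t := fun t ht =>
    pos_of_mul_le_deriv (g := fun t => κ * (1 - p t) * ((1 - θ t) ^ 2 - (1 - θa) ^ 2)) hpd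
      (by fun_prop) (fun s _ => le_of_eq (by ring)) (hpi ▸ hp0.1) ht
  have hθ_pos : ∀ t ∈ Ici (0:ℝ), 0 < θ t := fun t ht =>
    pos_of_mul_le_deriv
      (g := fun t => (1 - θ t) * ((1 - p t) * (1 - θ t) - Δ * p t * θ t)) hθd
      (by fun_prop) (fun s _ => le_of_eq (by ring)) (hθi ▸ hθ0.1) ht
  have hθ_lt : ∀ t ∈ Ici (0:ℝ), 0 < 1 - θ t := fun t ht =>
    pos_of_mul_le_deriv (f := fun t => 1 - θ t)
      (g := fun t => -(θ t * ((1 - p t) * (1 - θ t) - Δ * p t * θ t)))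
      (fun s hs => (hθd s hs).const_sub 1)
      (by fun_prop) (fun s _ => le_of_eq (by ring)) (by rw [hθi]; exact sub_pos.2 hθ0.2) ht
  refine fun t ht => ⟨hp_pos t ht, sub_nonneg.1 ?_⟩
  refine nonneg_of_mul_le_deriv (f := fun t => θb t - θ t)
    (g := fun t => 1 - 2 * (θ t + θb t) + (θ t ^ 2 + θ t * θb t + θb t ^ 2))
    (fun s hs => (hbode s hs).sub (hθd s hs)) (by fun_prop) (fun s hs => ?_)
    (by rw [hθi, hbinit, sub_self]) ht
  have hp := hp_pos s hs
  have hθ := hθ_pos s hs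
  have hθ' := hθ_lt s hs
  have hloss : 0 ≤ θ s * (1 - θ s) * (p s * ((1 - θ s) + Δ * θ s)) := by positivity
  linarith
end

section
/- Fix θ_a ∈ (0,1), κ > 0, Δ > 0 and an initial condition (θ₀, p₀) ∈ (0,1)² with θ₀ ≥ θ_a. Let (θ(t), p(t)) solve θ' = θ(1−θ)((1−p)(1−θ) − Δpθ), p' = κ p(1−p)((1−θ)² − (1−θ_a)²) with initial condition (θ₀, p₀), let θ̄(t) solve θ' = θ(1−θ)² with θ̄(0) = θ₀, and define the performance gap G_ℓ(t) = (1−p(t))(1−θ(t))² + p(t)(1−θ_a)² − (1−θ̄(t))². Then G_ℓ(t) > 0 for all t > 0; i.e., when the learner starts at least as skilled as the AI, delegation incurs strictly higher loss than the no-AI baseline at every positive time. -/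
open Set

/-- An integrating factor for `f' = a f + b` on `[0, ∞)`. -/
lemma exists_integrating_factor {f a b : ℝ → ℝ} (ha : ContinuousOn a (Ici 0))
    (hf : ∀ t ∈ Ici (0:ℝ), HasDerivWithinAt f (a t * f t + b t) (Ici 0) t) :
    ∃ E : ℝ → ℝ, (∀ t, 0 < E t) ∧
      ∀ t ∈ Ici (0:ℝ), HasDerivWithinAt (fun s => f s * E s) (b t * E t) (Ici 0) t := by
  have hc : Continuous fun t => a (max 0 t) :=
    ha.comp_continuous (by fun_prop) fun t => le_max_left 0 t
  refine ⟨fun t => Real.exp (-∫ s in (0:ℝ)..t, a (max 0 s)), fun t => Real.exp_pos _, ?_⟩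
  intro t ht
  have hA : HasDerivAt (fun u => ∫ s in (0:ℝ)..u, a (max 0 s)) (a (max 0 t)) t :=
    (hc.integral_hasStrictDerivAt 0 t).hasDerivAt
  rw [max_eq_right (mem_Ici.mp ht)] at hA
  refine ((hf t ht).mul hA.neg.exp.hasDerivWithinAt).congr_deriv ?_
  simp only [Pi.neg_apply]
  ring

/-- A solution of `f' = a f` on `[0, ∞)` that starts positive stays positive. -/
lemma pos_of_linear_ode {f a : ℝ → ℝ} (ha : ContinuousOn a (Ici 0))
    (hf : ∀ t ∈ Ici (0:ℝ), HasDerivWithinAt f (a t * f t) (Ici 0) t) (h0 : 0 < f 0) :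
    ∀ t ∈ Ici (0:ℝ), 0 < f t := by
  obtain ⟨E, hE, hfE⟩ := exists_integrating_factor (b := fun _ => 0) ha (by simpa using hf)
  intro t ht
  have hmono : MonotoneOn (fun s => f s * E s) (Ici 0) :=
    monotoneOn_of_hasDerivWithinAt_nonneg (convex_Ici 0)
      (fun s hs => (hfE s hs).continuousWithinAt)
      (fun s hs => (hfE s (interior_subset hs)).mono interior_subset) (by simp)
  have h := hmono self_mem_Ici ht ht
  exact pos_of_mul_pos_left ((mul_pos h0 (hE 0)).trans_le h) (hE t).le

/-- A solution of `f' = a f + b` on `[0, ∞)` with `b > 0` and `f 0 ≥ 0` is positive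
at positive times. -/
lemma pos_of_linear_ode_of_forcing_pos {f a b : ℝ → ℝ} (ha : ContinuousOn a (Ici 0))
    (hf : ∀ t ∈ Ici (0:ℝ), HasDerivWithinAt f (a t * f t + b t) (Ici 0) t)
    (hb : ∀ t ∈ Ici (0:ℝ), 0 < b t) (h0 : 0 ≤ f 0) {t : ℝ} (ht : 0 < t) : 0 < f t := by
  obtain ⟨E, hE, hfE⟩ := exists_integrating_factor ha hf
  have hmono : StrictMonoOn (fun s => f s * E s) (Ici 0) :=
    strictMonoOn_of_hasDerivWithinAt_pos (convex_Ici 0)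
      (fun s hs => (hfE s hs).continuousWithinAt)
      (fun s hs => (hfE s (interior_subset hs)).mono interior_subset)
      (fun s hs => mul_pos (hb s (interior_subset hs)) (hE s))
  have h := hmono self_mem_Ici ht.le ht
  exact pos_of_mul_pos_left ((mul_nonneg h0 (hE 0).le).trans_lt h) (hE t).le

/-- When the learner starts at least as skilled as the AI (`θ0 ≥ θa`), the
performance gap `G_ℓ(t) = (1-p(t))(1-θ(t))² + p(t)(1-θa)² - (1-θ̄(t))²` relative
to the no-AI baseline is strictly positive at every positive time. -/
theorem coupled_ode_gap_positive_when_skilled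
    (θa κ Δ : ℝ) (hθa : θa ∈ Ioo (0:ℝ) 1) (hκ : 0 < κ) (hΔ : 0 < Δ)
    (θ0 p0 : ℝ) (hθ0 : θ0 ∈ Ioo (0:ℝ) 1) (hp0 : p0 ∈ Ioo (0:ℝ) 1)
    (hskill : θa ≤ θ0)
    (θ p θb : ℝ → ℝ)
    (hinit : θ 0 = θ0 ∧ p 0 = p0) (hbinit : θb 0 = θ0)
    (hode : ∀ t ∈ Ici (0:ℝ),
      HasDerivWithinAt θ
        (θ t * (1 - θ t) * ((1 - p t) * (1 - θ t) - Δ * p t * θ t)) (Ici 0) t ∧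
      HasDerivWithinAt p
        (κ * p t * (1 - p t) * ((1 - θ t) ^ 2 - (1 - θa) ^ 2)) (Ici 0) t)
    (hbode : ∀ t ∈ Ici (0:ℝ),
      HasDerivWithinAt θb (θb t * (1 - θb t) ^ 2) (Ici 0) t) :
    ∀ t > (0:ℝ),
      0 < (1 - p t) * (1 - θ t) ^ 2 + p t * (1 - θa) ^ 2 - (1 - θb t) ^ 2 := by
  obtain ⟨hθi, hpi⟩ := hinit
  have cθ : ContinuousOn θ (Ici 0) := fun t ht => (hode t ht).1.continuousWithinAt
  have cp : ContinuousOn p (Ici 0) := fun t ht => (hode t ht).2.continuousWithinAt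
  have cb : ContinuousOn θb (Ici 0) := fun t ht => (hbode t ht).continuousWithinAt
  have p_pos : ∀ t ∈ Ici (0:ℝ), 0 < p t :=
    pos_of_linear_ode (a := fun t => κ * (1 - p t) * ((1 - θ t) ^ 2 - (1 - θa) ^ 2))
      (by fun_prop) (fun t ht => (hode t ht).2.congr_deriv (by ring)) (hpi ▸ hp0.1)
  have p_lt : ∀ t ∈ Ici (0:ℝ), 0 < 1 - p t :=
    pos_of_linear_ode (f := fun t => 1 - p t)
      (a := fun t => -(κ * p t * ((1 - θ t) ^ 2 - (1 - θa) ^ 2)))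
      (by fun_prop) (fun t ht => ((hode t ht).2.const_sub 1).congr_deriv (by ring))
      (by rw [hpi]; linarith [hp0.2])
  have θ_pos : ∀ t ∈ Ici (0:ℝ), 0 < θ t :=
    pos_of_linear_ode
      (a := fun t => (1 - θ t) * ((1 - p t) * (1 - θ t) - Δ * p t * θ t))
      (by fun_prop) (fun t ht => (hode t ht).1.congr_deriv (by ring)) (hθi ▸ hθ0.1)
  have θ_lt : ∀ t ∈ Ici (0:ℝ), 0 < 1 - θ t :=
    pos_of_linear_ode (f := fun t => 1 - θ t)
      (a := fun t => -(θ t * ((1 - p t) * (1 - θ t) - Δ * p t * θ t)))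
      (by fun_prop) (fun t ht => ((hode t ht).1.const_sub 1).congr_deriv (by ring))
      (by rw [hθi]; linarith [hθ0.2])
  have θb_pos : ∀ t ∈ Ici (0:ℝ), 0 < θb t :=
    pos_of_linear_ode (a := fun t => (1 - θb t) ^ 2)
      (by fun_prop) (fun t ht => (hbode t ht).congr_deriv (by ring)) (hbinit ▸ hθ0.1)
  have θb_lt : ∀ t ∈ Ici (0:ℝ), 0 < 1 - θb t :=
    pos_of_linear_ode (f := fun t => 1 - θb t) (a := fun t => -(θb t * (1 - θb t)))
      (by fun_prop) (fun t ht => ((hbode t ht).const_sub 1).congr_deriv (by ring))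
      (by rw [hbinit]; linarith [hθ0.2])
  have θb_mono : MonotoneOn θb (Ici 0) :=
    monotoneOn_of_hasDerivWithinAt_nonneg (convex_Ici 0) cb
      (fun s hs => (hbode s (interior_subset hs)).mono interior_subset)
      (fun s hs => mul_nonneg (θb_pos s (interior_subset hs)).le (sq_nonneg _))
  intro t ht
  have ht' : t ∈ Ici (0:ℝ) := ht.le
  have hlt : 0 < θb t - θ t :=
    pos_of_linear_ode_of_forcing_pos (f := fun t => θb t - θ t)
      (a := fun t => 1 - 2 * (θb t + θ t) + (θb t ^ 2 + θb t * θ t + θ t ^ 2))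
      (b := fun t => θ t * (1 - θ t) * p t * ((1 - θ t) + Δ * θ t))
      (by fun_prop)
      (fun t ht => ((hbode t ht).sub (hode t ht).1).congr_deriv (by ring))
      (fun t ht => by
        have := θ_pos t ht
        have := θ_lt t ht
        have := p_pos t ht
        positivity)
      (by rw [hθi, hbinit, sub_self]) ht
  have hge : θ0 ≤ θb t := hbinit ▸ θb_mono self_mem_Ici ht' ht.le
  have hb := θb_lt t ht'
  have h1 : 0 < (1 - θ t) ^ 2 - (1 - θb t) ^ 2 := by nlinarith
  have h2 : 0 ≤ (1 - θa) ^ 2 - (1 - θb t) ^ 2 := by nlinarith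
  linarith [mul_pos (p_lt t ht') h1, mul_nonneg (p_pos t ht').le h2]
end

section
/- Fix θ_a ∈ (0,1), κ > 0, Δ > 0 and an initial condition (θ₀, p₀) ∈ (0,1)² with θ₀ < θ_a. Let (θ(t), p(t)) solve θ' = θ(1−θ)((1−p)(1−θ) − Δpθ), p' = κ p(1−p)((1−θ)² − (1−θ_a)²) with initial condition (θ₀, p₀), let θ̄(t) solve θ' = θ(1−θ)² with θ̄(0) = θ₀, and define G_ℓ(t) = (1−p(t))(1−θ(t))² + p(t)(1−θ_a)² − (1−θ̄(t))². Then the crossing time t_c := inf{ t ≥ 0 : G_ℓ(t') > 0 for all t' > t } is finite; moreover t_c ≤ t*, where t* is the unique time with θ̄(t*) = θ_a, and θ̄(t_c) ≤ θ_a. -/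
open Set

/-- Integrating-factor form of Grönwall's lower bound: a solution of `y' ≥ g y` on `[0, ∞)`
dominates a positive multiple of its initial value at every later time. -/
theorem exists_pos_mul_le_of_mul_le_deriv {y f g : ℝ → ℝ}
    (hy : ∀ t ∈ Ici (0:ℝ), HasDerivWithinAt y (f t) (Ici 0) t)
    (hg : ContinuousOn g (Ici 0)) (hfg : ∀ t ∈ Ici (0:ℝ), g t * y t ≤ f t)
    {t : ℝ} (ht : 0 ≤ t) : ∃ e : ℝ, 0 < e ∧ y 0 * e ≤ y t := by
  have hgc : Continuous fun s => g (max 0 s) :=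
    hg.comp_continuous (by fun_prop) fun s => le_max_left 0 s
  set G : ℝ → ℝ := fun t => ∫ s in (0:ℝ)..t, g (max 0 s) with hG
  have hGd : ∀ t ∈ Ici (0:ℝ), HasDerivAt G (g t) t := by
    intro t ht
    have h := intervalIntegral.integral_hasDerivAt_right
      (hgc.intervalIntegrable 0 t) (hgc.stronglyMeasurableAtFilter _ _) hgc.continuousAt
    rwa [max_eq_right (mem_Ici.mp ht)] at h
  have hd : ∀ t ∈ Ici (0:ℝ), HasDerivWithinAt (fun t => y t * Real.exp (-G t))
      (f t * Real.exp (-G t) + y t * (Real.exp (-G t) * -g t)) (Ici 0) t := fun t ht =>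
    (hy t ht).mul (hGd t ht).hasDerivWithinAt.neg.exp
  have hm : MonotoneOn (fun t => y t * Real.exp (-G t)) (Ici 0) := by
    refine monotoneOn_of_hasDerivWithinAt_nonneg (convex_Ici 0)
      (fun t ht => (hd t ht).continuousWithinAt)
      (fun t ht => (hd t (interior_subset ht)).mono interior_subset) fun t ht => ?_
    have h := mul_nonneg (sub_nonneg.mpr (hfg t (interior_subset ht))) (Real.exp_pos (-G t)).le
    linarith
  have h := hm self_mem_Ici (mem_Ici.mpr ht) ht
  have hG0 : G 0 = 0 := by simp [hG]
  simp only [hG0, neg_zero, Real.exp_zero, mul_one] at h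
  refine ⟨Real.exp (G t), Real.exp_pos _, ?_⟩
  calc y 0 * Real.exp (G t) ≤ y t * Real.exp (-G t) * Real.exp (G t) := by gcongr
    _ = y t := by rw [mul_assoc, ← Real.exp_add]; simp

/-- A solution of the linear equation `y' = g y` on `[0, ∞)` that starts positive stays positive. -/
theorem pos_of_hasDerivWithinAt_mul {y g : ℝ → ℝ}
    (hy : ∀ t ∈ Ici (0:ℝ), HasDerivWithinAt y (g t * y t) (Ici 0) t)
    (hg : ContinuousOn g (Ici 0)) (h0 : 0 < y 0) {t : ℝ} (ht : 0 ≤ t) : 0 < y t := by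
  obtain ⟨e, he, h⟩ := exists_pos_mul_le_of_mul_le_deriv hy hg (fun _ _ => le_rfl) ht
  exact (mul_pos h0 he).trans_le h

/-- A solution of `y' = y (1 - y) g` on `[0, ∞)` that starts in `(0, 1)` stays in `(0, 1)`. -/
theorem mem_Ioo_of_hasDerivWithinAt_logistic {y g : ℝ → ℝ}
    (hy : ∀ t ∈ Ici (0:ℝ), HasDerivWithinAt y (y t * (1 - y t) * g t) (Ici 0) t)
    (hg : ContinuousOn g (Ici 0)) (h0 : y 0 ∈ Ioo (0:ℝ) 1) {t : ℝ} (ht : 0 ≤ t) :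
    y t ∈ Ioo (0:ℝ) 1 := by
  have hc : ContinuousOn y (Ici 0) := fun t ht => (hy t ht).continuousWithinAt
  constructor
  · refine pos_of_hasDerivWithinAt_mul (g := fun t => (1 - y t) * g t)
      (fun t ht => ?_) (by fun_prop) h0.1 ht
    exact (hy t ht).congr_deriv (by ring)
  · refine sub_pos.mp (pos_of_hasDerivWithinAt_mul (y := fun t => 1 - y t)
      (g := fun t => -(y t * g t)) (fun t ht => ?_) (by fun_prop) (sub_pos.mpr h0.2) ht)
    exact ((hy t ht).const_sub 1).congr_deriv (by ring)

/-- Short-term gains, long-term losses: when `θ0 < θa`, the crossing time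
`t_c = inf {t ≥ 0 : G_ℓ(t') > 0 for all t' > t}` is finite (the defining set is
nonempty), and `t_c ≤ t*` where `t*` is the unique time with `θ̄(t*) = θa`;
moreover `θ̄(t_c) ≤ θa`. -/
theorem coupled_ode_crossing_time
    (θa κ Δ : ℝ) (hθa : θa ∈ Ioo (0:ℝ) 1) (hκ : 0 < κ) (hΔ : 0 < Δ)
    (θ0 p0 : ℝ) (hθ0 : θ0 ∈ Ioo (0:ℝ) 1) (hp0 : p0 ∈ Ioo (0:ℝ) 1)
    (hskill : θ0 < θa)
    (θ p θb : ℝ → ℝ)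
    (hinit : θ 0 = θ0 ∧ p 0 = p0) (hbinit : θb 0 = θ0)
    (hode : ∀ t ∈ Ici (0:ℝ),
      HasDerivWithinAt θ
        (θ t * (1 - θ t) * ((1 - p t) * (1 - θ t) - Δ * p t * θ t)) (Ici 0) t ∧
      HasDerivWithinAt p
        (κ * p t * (1 - p t) * ((1 - θ t) ^ 2 - (1 - θa) ^ 2)) (Ici 0) t)
    (hbode : ∀ t ∈ Ici (0:ℝ),
      HasDerivWithinAt θb (θb t * (1 - θb t) ^ 2) (Ici 0) t) :
    ∃ tc tstar : ℝ,
      tc = sInf {t : ℝ | 0 ≤ t ∧ ∀ t' > t,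
        0 < (1 - p t') * (1 - θ t') ^ 2 + p t' * (1 - θa) ^ 2 - (1 - θb t') ^ 2} ∧
      ({t : ℝ | 0 ≤ t ∧ ∀ t' > t,
        0 < (1 - p t') * (1 - θ t') ^ 2 + p t' * (1 - θa) ^ 2
            - (1 - θb t') ^ 2}).Nonempty ∧
      0 < tstar ∧ θb tstar = θa ∧
      (∀ s, 0 ≤ s → θb s = θa → s = tstar) ∧
      tc ≤ tstar ∧ θb tc ≤ θa := by
  obtain ⟨hθi, hpi⟩ := hinit
  have hθc : ContinuousOn θ (Ici 0) := fun t ht => (hode t ht).1.continuousWithinAt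
  have hpc : ContinuousOn p (Ici 0) := fun t ht => (hode t ht).2.continuousWithinAt
  have hbc : ContinuousOn θb (Ici 0) := fun t ht => (hbode t ht).continuousWithinAt
  have hθm : ∀ t, 0 ≤ t → θ t ∈ Ioo (0:ℝ) 1 := fun t ht =>
    mem_Ioo_of_hasDerivWithinAt_logistic (fun t ht => (hode t ht).1) (by fun_prop)
      (hθi ▸ hθ0) ht
  have hpm : ∀ t, 0 ≤ t → p t ∈ Ioo (0:ℝ) 1 := fun t ht =>
    mem_Ioo_of_hasDerivWithinAt_logistic (g := fun t => κ * ((1 - θ t) ^ 2 - (1 - θa) ^ 2))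
      (fun t ht => (hode t ht).2.congr_deriv (by ring)) (by fun_prop) (hpi ▸ hp0) ht
  have hbm : ∀ t, 0 ≤ t → θb t ∈ Ioo (0:ℝ) 1 := fun t ht =>
    mem_Ioo_of_hasDerivWithinAt_logistic (g := fun t => 1 - θb t)
      (fun t ht => (hbode t ht).congr_deriv (by ring)) (by fun_prop) (hbinit ▸ hθ0) ht
  have hle : ∀ t, 0 ≤ t → θ t ≤ θb t := by
    intro t ht
    have h := exists_pos_mul_le_of_mul_le_deriv
      (g := fun t => 1 - 2 * (θb t + θ t) + θb t ^ 2 + θb t * θ t + θ t ^ 2)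
      (fun t ht => (hbode t ht).sub (hode t ht).1) (by fun_prop) (fun t ht => by
        obtain ⟨h1, h2⟩ := hθm t ht
        have h3 : 0 < 1 - θ t := sub_pos.mpr h2
        have h4 := (hpm t ht).1
        have h5 : 0 ≤ θ t * (1 - θ t) * (p t * (1 - θ t) + Δ * p t * θ t) := by positivity
        simp only [Pi.sub_apply]
        linarith) ht
    obtain ⟨e, -, h⟩ := h
    simp only [Pi.sub_apply, hbinit, hθi, sub_self, zero_mul] at h
    linarith
  have hmono : StrictMonoOn θb (Ici 0) := by
    refine strictMonoOn_of_hasDerivWithinAt_pos (convex_Ici 0) hbc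
      (fun t ht => (hbode t (interior_subset ht)).mono interior_subset) fun t ht => ?_
    obtain ⟨h1, h2⟩ := hbm t (interior_subset ht)
    have := sub_pos.mpr h2
    positivity
  obtain ⟨T, hT0, hT⟩ : ∃ T, 0 ≤ T ∧ θa ≤ θb T := by
    have hc : 0 < θ0 * (1 - θa) ^ 2 := mul_pos hθ0.1 (pow_pos (sub_pos.mpr hθa.2) 2)
    set c := θ0 * (1 - θa) ^ 2 with hcdef
    have hT0 : 0 ≤ (θa - θ0) / c := div_nonneg (sub_nonneg.mpr hskill.le) hc.le
    refine ⟨(θa - θ0) / c, hT0, ?_⟩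
    by_contra! hlt
    have hm : MonotoneOn (fun t => θb t - c * t) (Icc 0 ((θa - θ0) / c)) := by
      have hd : ∀ t ∈ Icc 0 ((θa - θ0) / c), HasDerivWithinAt (fun t => θb t - c * t)
          (θb t * (1 - θb t) ^ 2 - c * 1) (Icc 0 ((θa - θ0) / c)) t := fun t ht =>
        ((hbode t ht.1).mono Icc_subset_Ici_self).sub ((hasDerivWithinAt_id t _).const_mul c)
      refine monotoneOn_of_hasDerivWithinAt_nonneg (convex_Icc _ _)
        (fun t ht => (hd t ht).continuousWithinAt)
        (fun t ht => (hd t (interior_subset ht)).mono interior_subset) fun t ht => ?_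
      have ht' := interior_subset ht
      have h1 : θ0 ≤ θb t := hbinit ▸ hmono.monotoneOn self_mem_Ici ht'.1 ht'.1
      have h2 : θb t ≤ θa := (hmono.monotoneOn ht'.1 hT0 ht'.2).trans hlt.le
      have h3 : 0 ≤ 1 - θa := sub_nonneg.mpr hθa.2.le
      have h4 : c ≤ θb t * (1 - θb t) ^ 2 :=
        mul_le_mul h1 (pow_le_pow_left₀ h3 (by linarith) 2) (by positivity) (hbm t ht'.1).1.le
      linarith
    have h := hm ⟨le_rfl, hT0⟩ ⟨hT0, le_rfl⟩ hT0
    simp only [hbinit, mul_zero, sub_zero, mul_div_cancel₀ _ hc.ne'] at h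
    linarith
  obtain ⟨s, hs, hsa⟩ := intermediate_value_Icc hT0 (hbc.mono Icc_subset_Ici_self)
    ⟨hbinit ▸ hskill.le, hT⟩
  have hs0 : 0 < s := by
    refine lt_of_le_of_ne hs.1 ?_
    rintro rfl
    exact hskill.ne (hbinit.symm.trans hsa)
  have hmem : s ∈ {t : ℝ | 0 ≤ t ∧ ∀ t' > t,
      0 < (1 - p t') * (1 - θ t') ^ 2 + p t' * (1 - θa) ^ 2 - (1 - θb t') ^ 2} := by
    refine ⟨hs0.le, fun t ht => ?_⟩
    have ht0 : 0 ≤ t := (hs0.trans ht).le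
    have hb : 0 ≤ 1 - θb t := sub_nonneg.mpr (hbm t ht0).2.le
    have h1 : θa < θb t := hsa ▸ hmono hs.1 ht0 ht
    have h2 : (1 - θb t) ^ 2 < (1 - θa) ^ 2 := pow_lt_pow_left₀ (by linarith) hb two_ne_zero
    have h3 : (1 - θb t) ^ 2 ≤ (1 - θ t) ^ 2 := pow_le_pow_left₀ hb (by linarith [hle t ht0]) 2
    have h4 := mul_lt_mul_of_pos_left h2 (hpm t ht0).1
    have h5 := mul_le_mul_of_nonneg_left h3 (sub_nonneg.mpr (hpm t ht0).2.le)
    linarith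
  have htc := csInf_le ⟨0, fun _ h => h.1⟩ hmem
  refine ⟨_, s, rfl, ⟨s, hmem⟩, hs0, hsa, fun u hu hua => ?_, htc, ?_⟩
  · exact hmono.injOn hu hs.1 (hua.trans hsa.symm)
  · exact (hmono.monotoneOn (Real.sInf_nonneg fun _ h => h.1) hs.1 htc).trans hsa.le
end

section
/- Fix θ_a ∈ (0,1), κ > 0, Δ > 0 and an initial condition (θ₀, p₀) ∈ (0,1)². Let (θ(t), p(t)) solve θ' = θ(1−θ)((1−p)(1−θ) − Δpθ), p' = κ p(1−p)((1−θ)² − (1−θ_a)²) with initial condition (θ₀, p₀), let θ̄(t) solve θ' = θ(1−θ)² with θ̄(0) = θ₀, and define G_ℓ(t) = (1−p(t))(1−θ(t))² + p(t)(1−θ_a)² − (1−θ̄(t))². Then for every t > 0 with θ̄(t) > θ_a, one has G_ℓ(t) > 0; equivalently, at any positive time at which the AI assistance yields a (weak) performance advantage G_ℓ(t) ≤ 0, the baseline skill satisfies θ̄(t) ≤ θ_a. -/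
open Set

/-- Comparison for a linear differential inequality `f' ≥ a f` on `[0, ∞)`: the solution stays
above a positive multiple of its initial value. -/
theorem exists_pos_mul_le_of_hasDerivWithinAt {f a f' : ℝ → ℝ}
    (ha : ContinuousOn a (Ici 0))
    (hf : ∀ t ∈ Ici (0:ℝ), HasDerivWithinAt f (f' t) (Ici 0) t)
    (hle : ∀ t ∈ Ici (0:ℝ), a t * f t ≤ f' t) {t : ℝ} (ht : 0 ≤ t) :
    ∃ c > 0, c * f 0 ≤ f t := by
  let b : ℝ → ℝ := fun s => a (max s 0)
  have hb : Continuous b :=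
    ha.comp_continuous (by fun_prop) fun s => le_max_right s 0
  let A : ℝ → ℝ := fun s => ∫ x in (0:ℝ)..s, b x
  have hA : ∀ s, HasDerivAt A (b s) s := fun s =>
    intervalIntegral.integral_hasDerivAt_right (hb.intervalIntegrable _ _)
      (hb.stronglyMeasurableAtFilter _ _) hb.continuousAt
  have hg : ∀ s ∈ Ici (0:ℝ), HasDerivWithinAt (fun s => f s * Real.exp (-A s))
      ((f' s - a s * f s) * Real.exp (-A s)) (Ici 0) s := by
    intro s hs
    have hbs : b s = a s := congrArg a (max_eq_left hs)
    refine ((hf s hs).mul (hA s).neg.exp.hasDerivWithinAt).congr_deriv ?_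
    rw [hbs, Pi.neg_apply]
    ring
  have hmono : MonotoneOn (fun s => f s * Real.exp (-A s)) (Ici 0) := by
    refine monotoneOn_of_hasDerivWithinAt_nonneg (convex_Ici 0)
      (fun s hs => (hg s hs).continuousWithinAt)
      (fun s hs => (hg s (interior_subset hs)).mono interior_subset) fun s hs => ?_
    exact mul_nonneg (sub_nonneg.2 (hle s (interior_subset hs))) (Real.exp_pos _).le
  have h := hmono self_mem_Ici ht ht
  have hA0 : A 0 = 0 := intervalIntegral.integral_same
  simp only [hA0, neg_zero, Real.exp_zero, mul_one] at h
  refine ⟨Real.exp (A t), Real.exp_pos _, ?_⟩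
  calc Real.exp (A t) * f 0 ≤ Real.exp (A t) * (f t * Real.exp (-A t)) := by gcongr
    _ = f t * (Real.exp (A t) * Real.exp (-A t)) := by ring
    _ = f t := by rw [← Real.exp_add, add_neg_cancel, Real.exp_zero, mul_one]

/-- A solution of `f' = a f` on `[0, ∞)` with positive initial value stays positive. -/
theorem pos_of_hasDerivWithinAt_mul_self {f a : ℝ → ℝ}
    (ha : ContinuousOn a (Ici 0))
    (hf : ∀ t ∈ Ici (0:ℝ), HasDerivWithinAt f (a t * f t) (Ici 0) t)
    (h0 : 0 < f 0) {t : ℝ} (ht : 0 ≤ t) : 0 < f t := by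
  obtain ⟨c, hc, hle⟩ := exists_pos_mul_le_of_hasDerivWithinAt ha hf (fun _ _ => le_rfl) ht
  exact (mul_pos hc h0).trans_le hle

/-- At any positive time at which the no-AI baseline skill exceeds the AI skill
(`θ̄(t) > θa`), the performance gap
`G_ℓ(t) = (1-p(t))(1-θ(t))² + p(t)(1-θa)² - (1-θ̄(t))²` is strictly positive. -/
theorem coupled_ode_gap_positive_after_baseline_passes_ai
    (θa κ Δ : ℝ) (hθa : θa ∈ Ioo (0:ℝ) 1) (hκ : 0 < κ) (hΔ : 0 < Δ)
    (θ0 p0 : ℝ) (hθ0 : θ0 ∈ Ioo (0:ℝ) 1) (hp0 : p0 ∈ Ioo (0:ℝ) 1)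
    (θ p θb : ℝ → ℝ)
    (hinit : θ 0 = θ0 ∧ p 0 = p0) (hbinit : θb 0 = θ0)
    (hode : ∀ t ∈ Ici (0:ℝ),
      HasDerivWithinAt θ
        (θ t * (1 - θ t) * ((1 - p t) * (1 - θ t) - Δ * p t * θ t)) (Ici 0) t ∧
      HasDerivWithinAt p
        (κ * p t * (1 - p t) * ((1 - θ t) ^ 2 - (1 - θa) ^ 2)) (Ici 0) t)
    (hbode : ∀ t ∈ Ici (0:ℝ),
      HasDerivWithinAt θb (θb t * (1 - θb t) ^ 2) (Ici 0) t) :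
    ∀ t > (0:ℝ), θa < θb t →
      0 < (1 - p t) * (1 - θ t) ^ 2 + p t * (1 - θa) ^ 2 - (1 - θb t) ^ 2 := by
  obtain ⟨hθi, hpi⟩ := hinit
  have hθ := fun t ht => (hode t ht).1
  have hp := fun t ht => (hode t ht).2
  have cθ : ContinuousOn θ (Ici 0) := fun t ht => (hθ t ht).continuousWithinAt
  have cp : ContinuousOn p (Ici 0) := fun t ht => (hp t ht).continuousWithinAt
  have cb : ContinuousOn θb (Ici 0) := fun t ht => (hbode t ht).continuousWithinAt
  have p_pos : ∀ t, 0 ≤ t → 0 < p t := fun t ht =>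
    pos_of_hasDerivWithinAt_mul_self
      (a := fun t => κ * (1 - p t) * ((1 - θ t) ^ 2 - (1 - θa) ^ 2)) (by fun_prop)
      (fun s hs => (hp s hs).congr_deriv (by ring)) (hpi ▸ hp0.1) ht
  have p_lt : ∀ t, 0 ≤ t → 0 < 1 - p t := fun t ht =>
    pos_of_hasDerivWithinAt_mul_self (f := fun t => 1 - p t)
      (a := fun t => -(κ * p t * ((1 - θ t) ^ 2 - (1 - θa) ^ 2))) (by fun_prop)
      (fun s hs => ((hp s hs).const_sub 1).congr_deriv (by ring))
      (by simpa [hpi] using hp0.2) ht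
  have θ_pos : ∀ t, 0 ≤ t → 0 < θ t := fun t ht =>
    pos_of_hasDerivWithinAt_mul_self
      (a := fun t => (1 - θ t) * ((1 - p t) * (1 - θ t) - Δ * p t * θ t)) (by fun_prop)
      (fun s hs => (hθ s hs).congr_deriv (by ring)) (hθi ▸ hθ0.1) ht
  have θ_lt : ∀ t, 0 ≤ t → 0 < 1 - θ t := fun t ht =>
    pos_of_hasDerivWithinAt_mul_self (f := fun t => 1 - θ t)
      (a := fun t => -(θ t * ((1 - p t) * (1 - θ t) - Δ * p t * θ t))) (by fun_prop)
      (fun s hs => ((hθ s hs).const_sub 1).congr_deriv (by ring))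
      (by simpa [hθi] using hθ0.2) ht
  have θb_lt : ∀ t, 0 ≤ t → 0 < 1 - θb t := fun t ht =>
    pos_of_hasDerivWithinAt_mul_self (f := fun t => 1 - θb t)
      (a := fun t => -(θb t * (1 - θb t))) (by fun_prop)
      (fun s hs => ((hbode s hs).const_sub 1).congr_deriv (by ring))
      (by simpa [hbinit] using hθ0.2) ht
  have θ_le : ∀ t, 0 ≤ t → θ t ≤ θb t := by
    intro t ht
    obtain ⟨c, -, hle⟩ := exists_pos_mul_le_of_hasDerivWithinAt (f := fun t => θb t - θ t)
      (a := fun t => 1 - 2 * (θb t + θ t) + (θb t ^ 2 + θb t * θ t + θ t ^ 2)) (by fun_prop)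
      (fun s hs => (hbode s hs).sub (hθ s hs))
      (fun s hs => by
        have h1 := θ_pos s hs
        have h2 := θ_lt s hs
        have h3 := p_pos s hs
        have h4 : 0 ≤ θ s * (1 - θ s) * p s * (1 - θ s + Δ * θ s) := by positivity
        linear_combination h4) ht
    simpa [hθi, hbinit] using hle
  intro t ht hlt
  have hb := θb_lt t ht.le
  have h1 : (1 - θb t) ^ 2 ≤ (1 - θ t) ^ 2 := by
    gcongr
    exact θ_le t ht.le
  have h2 : (1 - θb t) ^ 2 < (1 - θa) ^ 2 := by gcongr
  linear_combination mul_le_mul_of_nonneg_left h1 (p_lt t ht.le).le +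
    mul_lt_mul_of_pos_left h2 (p_pos t ht.le)
end

section
/- Let θ_d ∈ (0,1), θ_a ∈ (θ_d, 1), κ > 0, Δ > 0 and let G(θ, p) = (θ(1−θ)((1−p)(1−θ) + Δp(θ_d − θ)), κ p(1−p)((1−θ)² − (1−θ_a)²)). Then the set of zeros of G in [0,1]² ∪ ({θ_d} × [0,1]) consists of the four corner points (0,0), (0,1), (1,0), (1,1), the point (θ_d, 1), and the interior point (θ†, p†) = (θ_a, (1−θ_a)/(1 − θ_a + Δ(θ_a − θ_d))); in particular (θ†, p†) is the unique zero of G in (0,1)² with p ∉ {0,1} and θ ∉ {0, θ_d, 1}. -/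
open Set

theorem skill_eq_zero_iff {θd θa Δ : ℝ} (hθa : θa ∈ Ioo θd 1) (hΔ : 0 < Δ) (p : ℝ) :
    (1 - p) * (1 - θa) + Δ * p * (θd - θa) = 0 ↔
      p = (1 - θa) / (1 - θa + Δ * (θa - θd)) := by
  have hpos : 0 < 1 - θa + Δ * (θa - θd) :=
    add_pos (sub_pos.2 hθa.2) (mul_pos hΔ (sub_pos.2 hθa.1))
  rw [eq_div_iff hpos.ne']
  constructor <;> intro h <;> linear_combination -h

theorem delegation_eq_zero_iff {θ θa κ : ℝ} (hθ : θ ≤ 1) (hθa : θa < 1) (hκ : 0 < κ) (p : ℝ) :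
    κ * p * (1 - p) * ((1 - θ) ^ 2 - (1 - θa) ^ 2) = 0 ↔ p = 0 ∨ p = 1 ∨ θ = θa := by
  have hsq : (1 - θ) ^ 2 - (1 - θa) ^ 2 = (θa - θ) * (2 - θ - θa) := by ring
  have hne : 2 - θ - θa ≠ 0 := by linarith
  simp only [hsq, mul_eq_zero, hκ.ne', hne, sub_eq_zero, false_or, or_false, or_assoc,
    eq_comm (a := (1 : ℝ)), eq_comm (a := θa)]

theorem coupled_ode_zero_iff {θd θa κ Δ θ : ℝ} (hθd : θd ∈ Ioo (0 : ℝ) 1)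
    (hθa : θa ∈ Ioo θd 1) (hκ : 0 < κ) (hΔ : 0 < Δ) (hθ : θ ∈ Icc (0 : ℝ) 1) (p : ℝ) :
    (θ * (1 - θ) * ((1 - p) * (1 - θ) + Δ * p * (θd - θ)) = 0 ∧
      κ * p * (1 - p) * ((1 - θ) ^ 2 - (1 - θa) ^ 2) = 0) ↔
      (θ, p) ∈ ({(0, 0), (0, 1), (1, 0), (1, 1), (θd, 1),
        (θa, (1 - θa) / (1 - θa + Δ * (θa - θd)))} : Set (ℝ × ℝ)) := by
  have ha0 : θa ≠ 0 := (hθd.1.trans hθa.1).ne'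
  have ha1 : 1 - θa ≠ 0 := (sub_pos.2 hθa.2).ne'
  rw [delegation_eq_zero_iff hθ.2 hθa.2 hκ]
  simp only [mem_insert_iff, mem_singleton_iff, Prod.mk.injEq]
  constructor
  · rintro ⟨h, rfl | rfl | rfl⟩
    · have : θ = 0 ∨ θ = 1 := by simpa [sub_eq_zero, eq_comm (a := (1 : ℝ)), or_assoc] using h
      tauto
    · have : θ = 0 ∨ θ = 1 ∨ θ = θd := by
        simpa [sub_eq_zero, hΔ.ne', eq_comm (a := (1 : ℝ)), eq_comm (a := θd), or_assoc] using h
      tauto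
    · have h' := (mul_eq_zero.1 h).resolve_left (mul_ne_zero ha0 ha1)
      have := (skill_eq_zero_iff hθa hΔ p).1 h'
      tauto
  · rintro (⟨rfl, rfl⟩ | ⟨rfl, rfl⟩ | ⟨rfl, rfl⟩ | ⟨rfl, rfl⟩ | ⟨rfl, rfl⟩ | ⟨rfl, hp⟩)
    iterate 5 simp
    exact ⟨by rw [(skill_eq_zero_iff hθa hΔ p).2 hp, mul_zero], .inr (.inr rfl)⟩

/-- Equilibria of the general coupled skill–delegation ODE with default skill
`θd`: the zeros of
`G(θ,p) = (θ(1-θ)((1-p)(1-θ) + Δp(θd-θ)), κ p(1-p)((1-θ)² - (1-θa)²))`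
in `[0,1]² ∪ ({θd} × [0,1])` are exactly the four corners, `(θd, 1)`, and the
interior point `(θa, (1-θa)/(1-θa+Δ(θa-θd)))`; the latter is the unique zero in
`(0,1)²` with `θ ∉ {0, θd, 1}` and `p ∉ {0,1}`. -/
theorem general_coupled_ode_equilibria
    (θd θa κ Δ : ℝ) (hθd : θd ∈ Ioo (0:ℝ) 1) (hθa : θa ∈ Ioo θd 1)
    (hκ : 0 < κ) (hΔ : 0 < Δ) :
    (∀ x ∈ (Icc (0:ℝ) 1 ×ˢ Icc (0:ℝ) 1) ∪ ({θd} ×ˢ Icc (0:ℝ) 1),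
      ((x.1 * (1 - x.1) * ((1 - x.2) * (1 - x.1) + Δ * x.2 * (θd - x.1)),
        κ * x.2 * (1 - x.2) * ((1 - x.1) ^ 2 - (1 - θa) ^ 2)) = ((0 : ℝ), (0 : ℝ)) ↔
        x ∈ ({(0, 0), (0, 1), (1, 0), (1, 1), (θd, 1),
              (θa, (1 - θa) / (1 - θa + Δ * (θa - θd)))} : Set (ℝ × ℝ)))) ∧
    (∀ x ∈ Ioo (0:ℝ) 1 ×ˢ Ioo (0:ℝ) 1,
      x.1 ≠ θd →
      (x.1 * (1 - x.1) * ((1 - x.2) * (1 - x.1) + Δ * x.2 * (θd - x.1)),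
        κ * x.2 * (1 - x.2) * ((1 - x.1) ^ 2 - (1 - θa) ^ 2)) = ((0 : ℝ), (0 : ℝ)) →
      x = (θa, (1 - θa) / (1 - θa + Δ * (θa - θd)))) := by
  constructor
  · rintro ⟨θ, p⟩ hx
    have hθ : θ ∈ Icc (0 : ℝ) 1 := by
      rcases hx with hx | hx
      · exact hx.1
      · rw [show θ = θd from hx.1]
        exact Ioo_subset_Icc_self hθd
    rw [Prod.mk.injEq]
    exact coupled_ode_zero_iff hθd hθa hκ hΔ hθ p
  · rintro ⟨θ, p⟩ ⟨hθ, hp⟩ - h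
    have hmem := (coupled_ode_zero_iff hθd hθa hκ hΔ (Ioo_subset_Icc_self hθ) p).1
      (Prod.mk.inj h)
    have hp0 : p ≠ 0 := hp.1.ne'
    have hp1 : p ≠ 1 := hp.2.ne
    simpa [hp0, hp1] using hmem
end
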